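/- arXiv:0903.3439 — 3 statements merged into one kernel-verified Lean document; each statement's English description precedes it below -/
import Mathlib

section
/- Under the assumptions above, for integers i ≥ j ≥ a + d one has J^i ω :_ω 𝔪^j = J^{i-j}(J^j ω :_ω 𝔪^j). Equivalently, for every l ≥ d, [ω]_{≥ l+1} = J·[ω]_{≥ l}. -/
/-- Integer power of an ideal; by convention nonpositive exponents give the unit ideal. -/
def ipow {R : Type*} [CommRing R] (I : Ideal R) (n : ℤ) : Ideal R := I ^ n.toNat

/-- The colon submodule `N :_M I = {x ∈ M | I • x ⊆ N}`. -/
def mcolon {R M : Type*} [CommRing R] [AddCommGroup M] [Module R M]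
    (N : Submodule R M) (I : Ideal R) : Submodule R M where
  carrier := {x | ∀ r ∈ I, r • x ∈ N}
  add_mem' := fun hx hy r hr => by simpa [smul_add] using N.add_mem (hx r hr) (hy r hr)
  zero_mem' := fun r hr => by simp
  smul_mem' := fun c x hx r hr => by
    rw [smul_comm]
    exact N.smul_mem c (hx r hr)

section Aux

open RingTheory.Sequence

lemma aux_span_smul_ind {R M : Type*} [CommRing R] [AddCommGroup M] [Module R M]
    {S : Set R} {N : Submodule R M} {P : M → Prop} (h0 : P 0)
    (hs : ∀ s ∈ S, ∀ n ∈ N, P (s • n)) (hadd : ∀ x z, P x → P z → P (x + z))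
    {x : M} (hx : x ∈ Ideal.span S • N) : P x := by
  refine Submodule.smul_induction_on hx ?_ hadd
  intro r hr
  induction hr using Submodule.span_induction with
  | mem s h => exact hs s h
  | zero => intro n _; simpa using h0
  | add a b _ _ iha ihb => intro n hn; rw [add_smul]; exact hadd _ _ (iha n hn) (ihb n hn)
  | smul c r _ ih =>
    intro n hn
    rw [smul_assoc, smul_comm]
    exact ih _ (N.smul_mem c hn)

/-- Package of the projections of a graded module. -/
structure AuxGr {k R M : Type*} [Field k] [CommRing R] [Algebra k R] [AddCommGroup M]
    [Module R M] [Module k M] (A : ℤ → Submodule k R) (w : ℤ → Submodule k M)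
    (π : ℤ → M →+ M) : Prop where
  mem : ∀ p x, π p x ∈ w p
  same : ∀ p x, x ∈ w p → π p x = x
  ne : ∀ p q x, x ∈ w p → p ≠ q → π q x = 0
  sum : ∀ x, ∃ s : Finset ℤ, x = ∑ p ∈ s, π p x
  smul : ∀ p q r x, r ∈ A p → π (p + q) (r • x) = r • π q x

lemma aux_exists_gr {k R M : Type*} [Field k] [CommRing R] [Algebra k R] [AddCommGroup M]
    [Module R M] [Module k M] (A : ℤ → Submodule k R) (w : ℤ → Submodule k M)
    (hwint : DirectSum.IsInternal w)
    (hwsmul : ∀ (p q : ℤ), ∀ r ∈ A p, ∀ x ∈ w q, r • x ∈ w (p + q)) :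
    ∃ π : ℤ → M →+ M, AuxGr A w π := by
  classical
  letI := hwint.chooseDecomposition
  refine ⟨fun p => ⟨⟨fun x => (DirectSum.decompose w x p : M), by simp⟩, by intro x z; simp⟩,
    ?_, ?_, ?_, ?_, ?_⟩
  · intro p x; exact (DirectSum.decompose w x p).2
  · intro p x hx; exact DirectSum.decompose_of_mem_same w hx
  · intro p q x hx hpq; exact DirectSum.decompose_of_mem_ne w hx hpq
  · intro x; exact ⟨_, (DirectSum.sum_support_decompose w x).symm⟩
  · intro p q r x hr
    show (DirectSum.decompose w (r • x) (p + q) : M) = r • (DirectSum.decompose w x q : M)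
    induction x using DirectSum.Decomposition.inductionOn w with
    | zero => simp
    | @homogeneous i m =>
      have h1 := hwsmul p i r hr m m.2
      by_cases hi : i = q
      · subst hi
        rw [DirectSum.decompose_of_mem_same w h1, DirectSum.decompose_of_mem_same w m.2]
      · rw [DirectSum.decompose_of_mem_ne w h1 (by omega),
          DirectSum.decompose_of_mem_ne w m.2 hi, smul_zero]
    | add m m' h h' => simp [smul_add, h, h']

section
variable {k R M : Type*} [Field k] [CommRing R] [Algebra k R] [AddCommGroup M]
    [Module R M] [Module k M] {A : ℤ → Submodule k R} {w : ℤ → Submodule k M}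
    {π : ℤ → M →+ M}

/-- Homogeneous submodule. -/
def AuxHom (π : ℤ → M →+ M) (N : Submodule R M) : Prop := ∀ x ∈ N, ∀ p, π p x ∈ N

lemma aux_hom_smul (h : AuxGr A w π) {S : Set R} (hS : ∀ s ∈ S, ∃ p, s ∈ A p)
    {N : Submodule R M} (hN : AuxHom π N) : AuxHom π (Ideal.span S • N) := by
  intro x hx
  refine aux_span_smul_ind (P := fun x => ∀ p, π p x ∈ Ideal.span S • N) ?_ ?_ ?_ hx
  · intro p; simp
  · intro s hs n hn p
    obtain ⟨q, hq⟩ := hS s hs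
    have := h.smul q (p - q) s n hq
    rw [add_sub_cancel] at this
    rw [this]
    exact Submodule.smul_mem_smul (Ideal.subset_span hs) (hN n hn _)
  · intro a b ha hb p
    rw [map_add]; exact Submodule.add_mem _ (ha p) (hb p)

lemma aux_hom_pow (h : AuxGr A w π) {S : Set R} (hS : ∀ s ∈ S, ∃ p, s ∈ A p) (n : ℕ) :
    AuxHom π (Ideal.span S ^ n • (⊤ : Submodule R M)) := by
  induction n with
  | zero => intro x _ p; simp
  | succ n ih =>
    rw [pow_succ', Submodule.mul_smul]
    exact aux_hom_smul h hS ih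

lemma aux_hom_mem (h : AuxGr A w π) {N : Submodule R M} {x : M} (hx : ∀ p, π p x ∈ N) : x ∈ N := by
  obtain ⟨s, hs⟩ := h.sum x
  rw [hs]; exact Submodule.sum_mem _ fun p _ => hx p

/-- graded Nakayama / intersection -/
lemma aux_inter (h : AuxGr A w π) {c : ℤ} (hc : ∀ p, p < c → w p = ⊥)
    {N : Submodule R M} (hN : AuxHom π N) {r : R} (hr : ∀ s : ℕ, r ^ s ∈ A s) {x : M}
    (hx : ∀ s : ℕ, ∃ m, x - r ^ s • m ∈ N) : x ∈ N := by
  refine aux_hom_mem h fun p => ?_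
  obtain ⟨m, hm⟩ := hx (p - c + 1).toNat
  have h1 := hN _ hm p
  have h2 := h.smul _ (p - (p - c + 1).toNat) _ m (hr (p - c + 1).toNat)
  rw [add_sub_cancel] at h2
  rw [map_sub, h2] at h1
  have h3 := h.mem (p - (p - c + 1).toNat) m
  rw [hc _ (by omega), Submodule.mem_bot] at h3
  rwa [h3, smul_zero, sub_zero] at h1

lemma aux_perm (h : AuxGr A w π) {c : ℤ} (hc : ∀ p, p < c → w p = ⊥)
    {rs rs' : List R} (hdeg : ∀ r ∈ rs, ∀ s : ℕ, r ^ s ∈ A s)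
    (hreg : IsWeaklyRegular M rs) (hp : rs.Perm rs') : IsWeaklyRegular M rs' := by
  refine hreg.prototype_perm hp ?_
  intro a b l hl
  dsimp only
  intro hK
  set N : Submodule R M := Ideal.ofList l • ⊤ with hNdef
  have hN : AuxHom π N := by
    refine aux_hom_smul h ?_ (fun x _ p => Submodule.mem_top)
    intro s hs
    exact ⟨1, by simpa using hdeg s (hl.subset (by simp_all)) 1⟩
  rw [eq_bot_iff]
  intro z hz
  obtain ⟨x, rfl⟩ := Submodule.mkQ_surjective N z
  have key : ∀ s : ℕ, ∀ z ∈ Submodule.torsionBy R (M ⧸ N) b, ∃ u, z = a ^ s • u := by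
    intro s
    induction s with
    | zero => intro z _; exact ⟨z, by simp⟩
    | succ s ih =>
      intro z hz
      rw [hK] at hz
      obtain ⟨z', hz', rfl⟩ := (Submodule.mem_smul_pointwise_iff_exists _ _ _).1 hz
      obtain ⟨u, rfl⟩ := ih z' hz'
      exact ⟨u, by rw [pow_succ', mul_smul]⟩
  have : x ∈ N := by
    refine aux_inter h hc hN (hdeg a (hl.subset (by simp))) ?_
    intro s
    obtain ⟨u, hu⟩ := key s _ hz
    obtain ⟨m, rfl⟩ := Submodule.mkQ_surjective N u
    refine ⟨m, ?_⟩
    rw [← Submodule.Quotient.mk_eq_zero, Submodule.Quotient.mk_sub, Submodule.Quotient.mk_smul]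
    simpa [sub_eq_zero] using hu
  simpa using this

end

section
variable {R M : Type*} [CommRing R] [AddCommGroup M] [Module R M] {d : ℕ}

/-- The submodule generated by the chosen powers. -/
def auxQ (M : Type*) [AddCommGroup M] [Module R M] (y : Fin d → R) (e : Fin d → ℕ)
    (S : Finset (Fin d)) : Submodule R M :=
  Ideal.span ((fun s => y s ^ e s) '' (S : Set (Fin d))) • ⊤

lemma aux_mem_Q_insert (y : Fin d → R) (e : Fin d → ℕ) (S : Finset (Fin d)) (t : Fin d) (x : M) :
    x ∈ auxQ M y e (insert t S) ↔ ∃ m : M, x - y t ^ e t • m ∈ auxQ M y e S := by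
  unfold auxQ
  rw [Finset.coe_insert, Set.image_insert_eq, Ideal.span_insert, Submodule.sup_smul,
    Submodule.ideal_span_singleton_smul, Submodule.mem_sup]
  constructor
  · rintro ⟨a, ha, b, hb, rfl⟩
    obtain ⟨m, _, rfl⟩ := (Submodule.mem_smul_pointwise_iff_exists _ _ _).1 ha
    exact ⟨m, by simpa using hb⟩
  · rintro ⟨m, hm⟩
    exact ⟨_, Submodule.smul_mem_pointwise_smul m _ _ Submodule.mem_top, _, hm, by abel⟩

lemma aux_Q_congr (y : Fin d → R) {e e' : Fin d → ℕ} {S : Finset (Fin d)}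
    (h : ∀ s ∈ S, e s = e' s) : auxQ M y e S = auxQ M y e' S := by
  unfold auxQ
  congr 2
  exact Set.image_congr fun s hs => by simp [h s hs]

lemma aux_Q_mem (y : Fin d → R) {e : Fin d → ℕ} {S : Finset (Fin d)} {t} (ht : t ∈ S)
    {r : R} (h : y t ^ e t ∣ r) (m : M) : r • m ∈ auxQ M y e S := by
  obtain ⟨c, rfl⟩ := h
  rw [mul_smul]
  exact Submodule.smul_mem_smul (Ideal.subset_span ⟨t, ht, rfl⟩) Submodule.mem_top

lemma aux_nzd (y : Fin d → R)
    (hbase : ∀ S : Finset (Fin d), ∀ t ∉ S, ∀ m : M, y t • m ∈ auxQ M y 1 S → m ∈ auxQ M y 1 S) :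
    ∀ (N : ℕ) (e : Fin d → ℕ) (S : Finset (Fin d)), ∑ s ∈ S, e s ≤ N → ∀ t ∉ S, ∀ m : M,
      y t • m ∈ auxQ M y e S → m ∈ auxQ M y e S := by
  classical
  intro N
  induction N with
  | zero =>
    intro e S hS t ht m hm
    rcases S.eq_empty_or_nonempty with rfl | ⟨s, hs⟩
    · have h1 : auxQ M y e ∅ = auxQ M y 1 ∅ := aux_Q_congr y (by simp)
      rw [h1] at hm ⊢
      exact hbase _ t ht m hm
    · have : e s = 0 := by
        have := Finset.single_le_sum (f := e) (fun _ _ => Nat.zero_le _) hs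
        omega
      simpa using aux_Q_mem (M := M) y (e := e) hs (r := 1) (by simp [this]) m
  | succ N ih =>
    intro e S hS t ht m hm
    by_cases h0 : ∃ s ∈ S, e s = 0
    · obtain ⟨s, hs, h0⟩ := h0
      simpa using aux_Q_mem (M := M) y (e := e) hs (r := 1) (by simp [h0]) m
    by_cases h1 : ∀ s ∈ S, e s = 1
    · have h1 : auxQ M y e S = auxQ M y 1 S := aux_Q_congr y (by simpa using h1)
      rw [h1] at hm ⊢
      exact hbase _ t ht m hm
    push Not at h0 h1
    obtain ⟨s, hs, hs1⟩ := h1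
    have hs0 := h0 s hs
    obtain ⟨S', hsS', rfl⟩ : ∃ S', s ∉ S' ∧ S = insert s S' :=
      ⟨S.erase s, by simp, (Finset.insert_erase hs).symm⟩
    obtain ⟨f, hf⟩ : ∃ f, e s = f + 1 := ⟨e s - 1, by omega⟩
    rw [Finset.sum_insert hsS'] at hS
    have hts : t ≠ s := fun hh => ht (by simp [hh])
    have htS' : t ∉ S' := fun hh => ht (by simp [hh])
    have hup : ∀ g : ℕ, auxQ M y (Function.update e s g) S' = auxQ M y e S' := fun g =>
      aux_Q_congr y fun u hu => by
        rw [Function.update_of_ne]; rintro rfl; exact hsS' hu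
    have hsum : ∀ g : ℕ, ∑ u ∈ insert s S', Function.update e s g u = g + ∑ u ∈ S', e u := by
      intro g
      rw [Finset.sum_insert hsS', Function.update_self]
      congr 1
      exact Finset.sum_congr rfl fun u hu => by
        rw [Function.update_of_ne]; rintro rfl; exact hsS' hu
    have hIns : ∀ g : ℕ, ∀ x : M, x ∈ auxQ M y (Function.update e s g) (insert s S') ↔
        ∃ m : M, x - y s ^ g • m ∈ auxQ M y e S' := by
      intro g x
      rw [aux_mem_Q_insert, hup, Function.update_self]
    have hA : ∀ g : ℕ, g < e s → ∀ x : M, (∃ m : M, y t • x - y s ^ g • m ∈ auxQ M y e S') →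
        ∃ m : M, x - y s ^ g • m ∈ auxQ M y e S' := by
      intro g hg x
      rw [← hIns, ← hIns]
      exact ih _ _ (by rw [hsum]; omega) t ht x
    rw [aux_mem_Q_insert, hf] at hm ⊢
    obtain ⟨m', hm'⟩ := hm
    obtain ⟨m1, hm1⟩ := hA 1 (by omega) m ⟨y s ^ f • m', by
      rw [pow_one, smul_smul, ← pow_succ']; exact hm'⟩
    rw [pow_one] at hm1
    have h2 : y s • (y t • m1 - y s ^ f • m') ∈ auxQ M y e S' := by
      have h3 := Submodule.sub_mem _ hm' (Submodule.smul_mem _ (y t) hm1)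
      convert h3 using 1
      module
    have h3 := ih e S' (by omega) s hsS' _ h2
    obtain ⟨m2, hm2⟩ := hA f (by omega) m1 ⟨m', h3⟩
    refine ⟨m2, ?_⟩
    have h4 := Submodule.add_mem _ hm1 (Submodule.smul_mem _ (y s) hm2)
    convert h4 using 1
    module

lemma aux_colon (y : Fin d → R)
    (hbase : ∀ S : Finset (Fin d), ∀ t ∉ S, ∀ m : M, y t • m ∈ auxQ M y 1 S → m ∈ auxQ M y 1 S)
    (N : ℕ) (S : Finset (Fin d)) : ∀ m : M,
      (∏ s ∈ S, y s ^ N) • m ∈ auxQ M y (fun s => if s ∈ S then N + 1 else 1) Finset.univ →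
      m ∈ auxQ M y 1 Finset.univ := by
  classical
  induction S using Finset.induction_on with
  | empty => intro m hm; simpa [Pi.one_def] using hm
  | insert t S ht ih =>
    intro m hm
    refine ih m ?_
    rw [Finset.prod_insert ht, mul_smul] at hm
    have hu : (Finset.univ : Finset (Fin d)) = insert t (Finset.univ.erase t) := by simp
    rw [hu, aux_mem_Q_insert] at hm ⊢
    have hc : auxQ M y (fun s => if s ∈ insert t S then N + 1 else 1) (Finset.univ.erase t)
        = auxQ M y (fun s => if s ∈ S then N + 1 else 1) (Finset.univ.erase t) := by
      refine aux_Q_congr y fun s hs => ?_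
      have : s ≠ t := by simpa using hs
      simp [this]
    rw [hc] at hm
    obtain ⟨c, hm⟩ := hm
    refine ⟨c, ?_⟩
    simp only [Finset.mem_insert_self, if_true, ht, if_false, pow_one] at hm ⊢
    have key : ∀ K : ℕ, ∀ x : M,
        y t ^ K • x ∈ auxQ M y (fun s => if s ∈ S then N + 1 else 1) (Finset.univ.erase t) →
        x ∈ auxQ M y (fun s => if s ∈ S then N + 1 else 1) (Finset.univ.erase t) := by
      intro K
      induction K with
      | zero => intro x hx; simpa using hx
      | succ K ihK =>
        intro x hx
        rw [pow_succ', mul_smul] at hx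
        exact ihK _ (aux_nzd y hbase _ _ _ le_rfl t (by simp) _ hx)
    refine key N _ ?_
    convert hm using 1
    rw [smul_sub, smul_smul (y t ^ N) (y t), ← pow_succ]

lemma aux_mon_mem (y : Fin d → R) (c : Fin d → ℕ) :
    ∏ t, y t ^ c t ∈ Ideal.span (Set.range y) ^ (∑ t, c t) := by
  rw [← Finset.prod_pow_eq_pow_sum]
  exact Ideal.prod_mem_prod fun t _ => Ideal.pow_mem_pow (Ideal.subset_span (Set.mem_range_self t)) _

lemma aux_pow_eq (y : Fin d → R) (s : ℕ) :
    Ideal.span (Set.range y) ^ s =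
      Ideal.span ((fun c : Fin d → ℕ => ∏ t, y t ^ c t) '' {c | ∑ t, c t = s}) := by
  classical
  apply le_antisymm
  · induction s with
    | zero =>
      rw [pow_zero, Ideal.one_eq_top, top_le_iff, Ideal.eq_top_iff_one]
      exact Ideal.subset_span ⟨0, by simp, by simp⟩
    | succ s ih =>
      rw [pow_succ']
      refine (Ideal.mul_mono_right ih).trans ?_
      rw [Ideal.span_mul_span', Ideal.span_le]
      rintro _ ⟨_, ⟨t, rfl⟩, _, ⟨c, hc, rfl⟩, rfl⟩
      refine Ideal.subset_span ⟨c + Pi.single t 1, ?_, ?_⟩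
      · simp only [Set.mem_setOf_eq] at hc ⊢
        simp [Finset.sum_add_distrib, hc]
      · simp only [Pi.add_apply, pow_add, Finset.prod_mul_distrib]
        rw [mul_comm]
        congr 1
        rw [Finset.prod_eq_single t]
        · simp
        · intro b _ hb; simp [hb]
        · simp
  · rw [Ideal.span_le]
    rintro _ ⟨c, hc, rfl⟩
    have := aux_mon_mem y c
    rwa [hc] at this

lemma aux_expand (y : Fin d → R) (s : ℕ) {x : M}
    (hx : x ∈ Ideal.span (Set.range y) ^ s • (⊤ : Submodule R M)) :
    ∃ m : (Fin d → ℕ) → M,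
      x = ∑ c ∈ Finset.piAntidiag Finset.univ s, (∏ t, y t ^ c t) • m c := by
  classical
  rw [aux_pow_eq] at hx
  refine aux_span_smul_ind (P := fun x => ∃ m : (Fin d → ℕ) → M,
      x = ∑ c ∈ Finset.piAntidiag Finset.univ s, (∏ t, y t ^ c t) • m c) ⟨0, by simp⟩ ?_ ?_ hx
  · rintro _ ⟨c, hc, rfl⟩ n _
    refine ⟨fun c' => if c' = c then n else 0, ?_⟩
    simp only [Set.mem_setOf_eq] at hc
    simp [smul_ite, hc]
  · rintro _ _ ⟨m, rfl⟩ ⟨m', rfl⟩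
    exact ⟨m + m', by simp [smul_add, Finset.sum_add_distrib]⟩

lemma aux_regular_colon (y : Fin d → R) (hd : 1 ≤ d)
    (hbase : ∀ S : Finset (Fin d), ∀ t ∉ S, ∀ m : M, y t • m ∈ auxQ M y 1 S → m ∈ auxQ M y 1 S)
    (N : ℕ) (x : M)
    (hx : ∀ b : Fin d → ℕ, ∑ t, b t = N * (d - 1) →
      (∏ t, y t ^ b t) • x ∈ auxQ M y (fun _ => N + 1) Finset.univ) :
    ∀ s ≤ N + 1, x ∈ Ideal.span (Set.range y) ^ s • (⊤ : Submodule R M) := by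
  classical
  have hx' : ∀ r ∈ Ideal.span (Set.range y) ^ (N * (d - 1)),
      r • x ∈ auxQ M y (fun _ => N + 1) Finset.univ := by
    intro r hr
    rw [aux_pow_eq] at hr
    induction hr using Submodule.span_induction with
    | mem s h => obtain ⟨c, hc, rfl⟩ := h; exact hx c hc
    | zero => simp
    | add a b _ _ iha ihb => rw [add_smul]; exact Submodule.add_mem _ iha ihb
    | smul c r _ ih => rw [smul_assoc]; exact Submodule.smul_mem _ _ ih
  intro s
  induction s with
  | zero => intro _; simp
  | succ s ih =>
    intro hs
    obtain ⟨m, hm⟩ := aux_expand y s (ih (by omega))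
    have hJ : auxQ M y 1 Finset.univ = Ideal.span (Set.range y) • (⊤ : Submodule R M) := by
      unfold auxQ; simp
    rw [hm]
    refine Submodule.sum_mem _ fun c hc => ?_
    have hcs : ∑ t, c t = s := by simpa using hc
    rw [pow_succ, Submodule.mul_smul, ← hJ]
    refine Submodule.smul_mem_smul (hcs ▸ aux_mon_mem y c) ?_
    refine aux_colon y hbase N Finset.univ (m c) ?_
    simp only [Finset.mem_univ, if_true]
    have hcle : ∀ t, c t ≤ N := fun t => by
      have := Finset.single_le_sum (f := c) (fun _ _ => Nat.zero_le _) (Finset.mem_univ t)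
      omega
    have hb : ∑ t, (N - c t) + s = N * d := by
      rw [← hcs, ← Finset.sum_add_distrib]
      simp [Nat.sub_add_cancel (hcle _), mul_comm]
    have hge : N * (d - 1) ≤ ∑ t, (N - c t) := by
      obtain ⟨d', rfl⟩ : ∃ d', d = d' + 1 := ⟨d - 1, by omega⟩
      rw [mul_add] at hb
      simp only [Nat.add_sub_cancel]
      omega
    have h1 := hx' _ (Ideal.pow_le_pow_right hge (aux_mon_mem y fun t => N - c t))
    rw [hm, Finset.smul_sum, ← Finset.add_sum_erase _ _ hc] at h1
    rw [Submodule.add_mem_iff_left] at h1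
    · rw [smul_smul, ← Finset.prod_mul_distrib] at h1
      simpa only [← pow_add, Nat.sub_add_cancel (hcle _)] using h1
    · refine Submodule.sum_mem _ fun c' hc' => ?_
      obtain ⟨hne, hc'⟩ := Finset.mem_erase.1 hc'
      have hc's : ∑ t, c' t = s := by simpa using hc'
      obtain ⟨t, ht⟩ : ∃ t, c t < c' t := by
        by_contra hcon
        push Not at hcon
        apply hne
        have := (Finset.sum_eq_sum_iff_of_le (fun t _ => hcon t)).1 (hc's.trans hcs.symm)
        exact funext fun t => this t (Finset.mem_univ t)
      rw [smul_smul, ← Finset.prod_mul_distrib]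
      refine aux_Q_mem y (Finset.mem_univ t) ?_ _
      refine dvd_trans ?_ (Finset.dvd_prod_of_mem _ (Finset.mem_univ t))
      rw [← pow_add]
      exact pow_dvd_pow _ (by have := hcle t; omega)

lemma aux_pigeon (y : Fin d → R) (hd : 1 ≤ d) (N : ℕ) (b : Fin d → ℕ)
    (hb : ∑ t, b t = N * (d - 1)) {x : M}
    (hx : x ∈ Ideal.span (Set.range y) ^ (N + 1) • (⊤ : Submodule R M)) :
    (∏ t, y t ^ b t) • x ∈ auxQ M y (fun _ => N + 1) Finset.univ := by
  obtain ⟨m, rfl⟩ := aux_expand y _ hx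
  rw [Finset.smul_sum]
  refine Submodule.sum_mem _ fun c hc => ?_
  have hcs : ∑ t, c t = N + 1 := by simpa using hc
  obtain ⟨t, ht⟩ : ∃ t, N < b t + c t := by
    by_contra hcon
    push Not at hcon
    have h1 := Finset.sum_le_sum fun t (_ : t ∈ Finset.univ) => hcon t
    rw [Finset.sum_add_distrib, hb, hcs] at h1
    obtain ⟨d', rfl⟩ : ∃ d', d = d' + 1 := ⟨d - 1, by omega⟩
    simp at h1
    nlinarith
  rw [smul_smul, ← Finset.prod_mul_distrib]
  refine aux_Q_mem y (Finset.mem_univ t) ?_ _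
  refine dvd_trans ?_ (Finset.dvd_prod_of_mem _ (Finset.mem_univ t))
  rw [← pow_add]
  exact pow_dvd_pow _ ht

end

lemma aux_base {k R M : Type*} [Field k] [CommRing R] [Algebra k R] [AddCommGroup M]
    [Module R M] [Module k M] {A : ℤ → Submodule k R} {w : ℤ → Submodule k M}
    {π : ℤ → M →+ M} (h : AuxGr A w π) {c : ℤ} (hc : ∀ p, p < c → w p = ⊥) {d : ℕ}
    (y : Fin d → R) (hdeg : ∀ t, ∀ s : ℕ, y t ^ s ∈ A s)
    (hreg : IsWeaklyRegular M (List.ofFn y)) :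
    ∀ S : Finset (Fin d), ∀ t ∉ S, ∀ m : M, y t • m ∈ auxQ M y 1 S → m ∈ auxQ M y 1 S := by
  classical
  intro S t ht m hm
  have hperm : (List.ofFn y).Perm
      (S.toList.map y ++ (y t :: ((Finset.univ \ insert t S).toList.map y))) := by
    rw [List.ofFn_eq_map, ← List.map_cons, ← List.map_append]
    refine List.Perm.map y ?_
    rw [List.perm_ext_iff_of_nodup (List.nodup_finRange d)]
    · intro s
      simp
      tauto
    · rw [List.nodup_append, List.nodup_cons]
      refine ⟨S.nodup_toList, ⟨by simp, Finset.nodup_toList _⟩, ?_⟩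
      intro a ha b hb
      simp at ha hb
      rintro rfl
      rcases hb with rfl | hb
      · exact ht ha
      · exact hb.2 ha
  have hr := aux_perm h hc (by
    intro r hr
    rw [List.mem_ofFn] at hr
    obtain ⟨t, rfl⟩ := hr
    exact hdeg t) hreg hperm
  rw [isWeaklyRegular_append_iff, isWeaklyRegular_cons_iff] at hr
  have hr := hr.2.1
  rw [isSMulRegular_quotient_iff_mem_of_smul_mem] at hr
  have hQ : auxQ M y 1 S = Ideal.ofList (S.toList.map y) • ⊤ := by
    unfold auxQ Ideal.ofList
    congr 2
    ext z
    simp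
  rw [hQ] at hm ⊢
  exact hr m hm

end Aux

/-- **Theorem 2.3(b)**: for integers `i ≥ j ≥ a + d` one has
`J^i ω :_ω 𝔪^j = J^(i-j) (J^j ω :_ω 𝔪^j)`; equivalently, for every `l ≥ d`,
`[ω]_{≥ l+1} = J·[ω]_{≥ l}`. -/
theorem statement_3
    {k R : Type*} [Field k] [CommRing R] [Algebra k R] [IsNoetherianRing R]
    -- `R` is standard graded over `k`:
    (𝒜 : ℤ → Submodule k R) [GradedAlgebra 𝒜]
    (hneg : ∀ i : ℤ, i < 0 → 𝒜 i = ⊥)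
    (hstd : ∀ i : ℤ, 0 ≤ i → 𝒜 (i + 1) = 𝒜 1 * 𝒜 i)
    -- of dimension `d ≥ 1`:
    (d : ℕ) (hd : 1 ≤ d) (hdim : ringKrullDim R = d)
    -- `𝔪` is the homogeneous maximal ideal:
    (𝔪 : Ideal R) (h𝔪 : 𝔪 = Ideal.span (𝒜 1 : Set R))
    -- `y` is a linear system of parameters; its regularity encodes that `R` is Cohen–Macaulay:
    (y : Fin d → R) (hy1 : ∀ t, y t ∈ 𝒜 1)
    (hyreg : RingTheory.Sequence.IsRegular R (List.ofFn y))
    (J : Ideal R) (hJ : J = Ideal.span (Set.range y))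
    (hsop : 𝔪 ≤ J.radical)
    -- the `a`-invariant (the negative of the initial degree of the canonical module `ω`):
    (a : ℤ) (ha : 0 ≤ a + d)
    -- `J` is a reduction of `𝔪` with reduction number `a + d`:
    (hred : ∀ n : ℤ, a + d ≤ n → ipow 𝔪 (n + 1) = J * ipow 𝔪 n)
    -- `ω` is the graded canonical module of `R`: a finitely generated faithful graded
    -- maximal Cohen–Macaulay module with initial degree `-a`, generated in degrees `≤ d`,
    -- whose Artinian reductions `ω/J^{[n]}ω` have socle concentrated in degree `n·d`:
    {ω : Type*} [AddCommGroup ω] [Module R ω] [Module k ω] [IsScalarTower k R ω]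
    (w : ℤ → Submodule k ω)
    (hwint : DirectSum.IsInternal w)
    (hwsmul : ∀ (p q : ℤ), ∀ r ∈ 𝒜 p, ∀ x ∈ w q, r • x ∈ w (p + q))
    [Module.Finite R ω]
    (hfaith : Module.annihilator R ω = ⊥)
    (hbelow : ∀ p : ℤ, p < -a → w p = ⊥)
    (hinit : w (-a) ≠ ⊥)
    (hgend : Submodule.span R (⋃ p : ℤ, ⋃ (_ : p ≤ (d : ℤ)), (w p : Set ω)) = ⊤)
    (hregw : RingTheory.Sequence.IsRegular ω (List.ofFn y))
    (hsoc : ∀ n : ℕ, ∀ x : ω,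
      (∀ m ∈ 𝔪, m • x ∈ (Ideal.span (Set.range fun t => y t ^ n)) • (⊤ : Submodule R ω)) →
      ∃ u ∈ (Ideal.span (Set.range fun t => y t ^ n)) • (⊤ : Submodule R ω),
        ∃ v ∈ w ((n : ℤ) * d), x = u + v)
    (i j : ℤ) (hj : a + d ≤ j) (hij : j ≤ i) :
    mcolon ((ipow J i) • (⊤ : Submodule R ω)) (ipow 𝔪 j)
      = ipow J (i - j) • mcolon ((ipow J j) • (⊤ : Submodule R ω)) (ipow 𝔪 j)
    ∧ ∀ l : ℤ, (d : ℤ) ≤ l →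
        Submodule.span R (⋃ p : ℤ, ⋃ (_ : l + 1 ≤ p), (w p : Set ω))
          = J • Submodule.span R (⋃ p : ℤ, ⋃ (_ : l ≤ p), (w p : Set ω)) := by
  classical
  obtain ⟨π, hG⟩ := aux_exists_gr 𝒜 w hwint hwsmul
  have hdeg : ∀ t, ∀ s : ℕ, y t ^ s ∈ 𝒜 s := by
    intro t s
    simpa using SetLike.pow_mem_graded s (hy1 t)
  have hbase := aux_base hG hbelow y hdeg hregw.toIsWeaklyRegular
  have hQn : ∀ n : ℕ, Ideal.span (Set.range fun t => y t ^ n) • (⊤ : Submodule R ω)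
      = auxQ ω y (fun _ => n) Finset.univ := by
    intro n; unfold auxQ; simp
  have hyhom : ∀ s ∈ Set.range y, ∃ p, s ∈ 𝒜 p := by
    rintro _ ⟨t, rfl⟩; exact ⟨1, hy1 t⟩
  have hyJ : ∀ t, y t ∈ J := fun t => hJ ▸ Ideal.subset_span (Set.mem_range_self t)
  have hJm : J ≤ 𝔪 := by
    rw [hJ, Ideal.span_le]
    rintro _ ⟨t, rfl⟩
    rw [h𝔪]
    exact Ideal.subset_span (hy1 t)
  -- socle condition for homogeneous elements
  have hsoc' : ∀ (n : ℕ) (p : ℤ) (x : ω), x ∈ w p → p ≠ (n : ℤ) * d →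
      (∀ r ∈ 𝔪, r • x ∈ auxQ ω y (fun _ => n) Finset.univ) →
      x ∈ auxQ ω y (fun _ => n) Finset.univ := by
    intro n p x hx hp hm
    rw [← hQn] at hm ⊢
    obtain ⟨u, hu, v, hv, hxuv⟩ := hsoc n x hm
    have h1 : x = π p u := by
      rw [← hG.same p x hx]
      conv_lhs => rw [hxuv]
      rw [map_add, hG.ne _ p v hv hp.symm, add_zero]
    rw [h1]
    refine aux_hom_smul hG ?_ (fun x _ p => Submodule.mem_top) u hu p
    rintro _ ⟨t, rfl⟩
    exact ⟨n, hdeg t n⟩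
  have hspan𝔪 : ∀ (N : Submodule R ω) (x : ω), (∀ r ∈ 𝒜 1, r • x ∈ N) → ∀ r ∈ 𝔪, r • x ∈ N := by
    intro N x hx r hr
    rw [h𝔪] at hr
    induction hr using Submodule.span_induction with
    | mem s h => exact hx s h
    | zero => simp
    | add a b _ _ iha ihb => rw [add_smul]; exact Submodule.add_mem _ iha ihb
    | smul c r _ ih => rw [smul_assoc]; exact Submodule.smul_mem _ _ ih
  have h1𝔪 : ∀ r ∈ 𝒜 1, r ∈ 𝔪 := fun r hr => h𝔪 ▸ Ideal.subset_span hr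
  -- everything in degrees above `d` lies in `J ω`
  have hQ1 : auxQ ω y (fun _ => 1) Finset.univ = J • (⊤ : Submodule R ω) := by
    rw [← hQn]; simp [hJ]
  have habove : ∀ p : ℤ, (d : ℤ) < p → ∀ x ∈ w p, x ∈ J • (⊤ : Submodule R ω) := by
    have h1 : ∀ N : ℕ, ∀ p : ℤ, (d : ℤ) < p → ∀ x ∈ w p,
        (∀ r ∈ 𝔪 ^ N, r • x ∈ J • (⊤ : Submodule R ω)) → x ∈ J • (⊤ : Submodule R ω) := by
      intro N
      induction N with
      | zero => intro p _ x _ hx; simpa using hx 1 (by simp)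
      | succ N ih =>
        intro p hp x hx hN
        rw [← hQ1]
        refine hsoc' 1 p x hx (by push_cast; omega) ?_
        rw [hQ1]
        refine hspan𝔪 _ _ fun r hr => ?_
        refine ih (1 + p) (by omega) _ (hwsmul 1 p r hr x hx) fun s hs => ?_
        rw [smul_smul]
        exact hN _ (by rw [pow_succ]; exact Ideal.mul_mem_mul hs (h1𝔪 r hr))
    obtain ⟨N, hN⟩ := Ideal.exists_pow_le_of_le_radical_of_fg hsop (IsNoetherian.noetherian 𝔪)
    intro p hp x hx
    exact h1 N p hp x hx fun r hr => Submodule.smul_mem_smul (hN hr) Submodule.mem_top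
  -- truncations
  set W : ℤ → Submodule R ω := fun l =>
    Submodule.span R (⋃ p : ℤ, ⋃ (_ : l ≤ p), (w p : Set ω)) with hW
  have hmemW : ∀ l p : ℤ, l ≤ p → ∀ x ∈ w p, x ∈ W l := by
    intro l p hlp x hx
    exact Submodule.subset_span (Set.mem_iUnion₂.2 ⟨p, hlp, hx⟩)
  have hWle : ∀ (l : ℤ) (N : Submodule R ω), (∀ p, l ≤ p → ∀ x ∈ w p, x ∈ N) → W l ≤ N := by
    intro l N h
    refine Submodule.span_le.2 fun x hx => ?_
    obtain ⟨p, hp, hx⟩ := Set.mem_iUnion₂.1 hx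
    exact h p hp x hx
  have hWanti : ∀ l l' : ℤ, l ≤ l' → W l' ≤ W l := fun l l' hl =>
    hWle _ _ fun p hp x hx => hmemW l p (hl.trans hp) x hx
  have hmW : ∀ l : ℤ, 𝔪 • W l ≤ W (l + 1) := by
    intro l
    rw [Submodule.smul_le]
    intro r hr x hx
    have : W l ≤ mcolon (W (l + 1)) 𝔪 := by
      refine hWle _ _ fun p hp x hx => ?_
      exact hspan𝔪 _ _ fun r hr => hmemW _ (1 + p) (by omega) _ (hwsmul 1 p r hr x hx)
    exact this hx r hr
  have hmWn : ∀ (n : ℕ) (l : ℤ), 𝔪 ^ n • W l ≤ W (l + n) := by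
    intro n
    induction n with
    | zero => intro l; simp
    | succ n ih =>
      intro l
      rw [pow_succ', Submodule.mul_smul]
      refine (smul_mono_right _ (ih l)).trans ((hmW _).trans (le_of_eq ?_))
      congr 1; push_cast; ring
  have hpart2 : ∀ l : ℤ, (d : ℤ) ≤ l → W (l + 1) = J • W l := by
    intro l hl
    apply le_antisymm
    · refine hWle _ _ fun p hp x hx => ?_
      have h1 : ∀ x ∈ J • (⊤ : Submodule R ω), π p x ∈ J • W l := by
        intro x hx
        rw [hJ] at hx
        refine aux_span_smul_ind (P := fun x => π p x ∈ J • W l) (by simp) ?_ ?_ hx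
        · rintro _ ⟨t, rfl⟩ m _
          have := hG.smul 1 (p - 1) (y t) m (hy1 t)
          rw [add_sub_cancel] at this
          rw [this]
          exact Submodule.smul_mem_smul (hyJ t) (hmemW l (p - 1) (by omega) _ (hG.mem _ _))
        · intro a b ha hb
          rw [map_add]; exact Submodule.add_mem _ ha hb
      have := h1 x (habove p (by omega) x hx)
      rwa [hG.same p x hx] at this
    · exact (Submodule.smul_mono_left hJm).trans (hmW l)
  refine ⟨?_, hpart2⟩
  have hWpow : ∀ n : ℕ, W (d + n) = J ^ n • W d := by
    intro n
    induction n with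
    | zero => simp
    | succ n ih =>
      rw [pow_succ', Submodule.mul_smul, ← ih, ← hpart2 _ (by omega)]
      congr 1
  have hWtop : W (-a) = ⊤ := by
    rw [eq_top_iff]
    intro x _
    refine aux_hom_mem hG fun p => ?_
    by_cases hp : p < -a
    · have := hG.mem p x
      rw [hbelow p hp, Submodule.mem_bot] at this
      rw [this]; exact Submodule.zero_mem _
    · exact hmemW _ p (by omega) _ (hG.mem p x)
  -- socle of `ω / J^n ω`
  have hsocJ : ∀ (n : ℕ) (p : ℤ), p < n + d - 1 → ∀ x ∈ w p,
      (∀ r ∈ 𝔪, r • x ∈ J ^ n • (⊤ : Submodule R ω)) → x ∈ J ^ n • (⊤ : Submodule R ω) := by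
    intro n p hp x hx hm
    rcases n with _ | N
    · simp
    rw [hJ] at hm ⊢
    refine aux_regular_colon y hd hbase N x ?_ (N + 1) le_rfl
    intro b hb
    have hbdeg : (∏ t, y t ^ b t) ∈ 𝒜 ((N * (d - 1) : ℕ) : ℤ) := by
      rw [← hb]
      push_cast
      exact SetLike.prod_mem_graded _ _ _ fun t _ => hdeg t (b t)
    refine hsoc' (N + 1) _ _ (hwsmul _ p _ hbdeg x hx) ?_ ?_
    · obtain ⟨d', rfl⟩ : ∃ d', d = d' + 1 := ⟨d - 1, by omega⟩
      simp only [Nat.add_sub_cancel]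
      push_cast at hp ⊢
      apply ne_of_lt
      nlinarith
    · intro r hr
      rw [smul_comm]
      exact aux_pigeon y hd N b hb (hm r hr)
  have hcol : ∀ (n j : ℕ) (p : ℤ), p + j < n + d → ∀ x : ω,
      (∀ r ∈ 𝔪 ^ j, r • x ∈ J ^ n • (⊤ : Submodule R ω)) →
      π p x ∈ J ^ n • (⊤ : Submodule R ω) := by
    intro n j
    induction j with
    | zero =>
      intro p _ x hx
      have := hx 1 (by simp)
      rw [one_smul] at this
      rw [hJ] at this ⊢
      exact aux_hom_pow hG hyhom n x this p
    | succ j ih =>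
      intro p hp x hx
      push_cast at hp
      refine hsocJ n p (by omega) _ (hG.mem p x) (hspan𝔪 _ _ fun r hr => ?_)
      rw [← hG.smul 1 p r x hr]
      refine ih (1 + p) (by omega) _ fun s hs => ?_
      rw [smul_smul]
      exact hx _ (by rw [pow_succ]; exact Ideal.mul_mem_mul hs (h1𝔪 r hr))
  have hmain : ∀ i j : ℕ, a + d ≤ j → j ≤ i →
      mcolon (J ^ i • (⊤ : Submodule R ω)) (𝔪 ^ j) = W (d + (i - j : ℕ)) := by
    intro i j hj hij
    apply le_antisymm
    · intro x hx
      refine aux_hom_mem hG fun p => ?_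
      by_cases hp : p + j < i + d
      · have h1 := hcol i j p hp x hx
        have h2 : J ^ i • (⊤ : Submodule R ω) ≤ W (-a + i) := by
          rw [← hWtop]
          exact (Submodule.smul_mono_left (Ideal.pow_right_mono hJm i)).trans (hmWn i _)
        exact hWanti _ _ (by omega) (h2 h1)
      · exact hmemW _ p (by omega) _ (hG.mem p x)
    · intro x hx r hr
      have h1 := hmWn j _ (Submodule.smul_mem_smul hr hx)
      have h2 : (d : ℤ) + (i - j : ℕ) + j = d + i := by omega
      rw [h2, hWpow] at h1
      exact (show J ^ i • W d ≤ J ^ i • (⊤ : Submodule R ω) from smul_mono_right _ le_top) h1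
  lift j to ℕ using by omega
  lift i to ℕ using by omega
  have hij' : j ≤ i := by omega
  have h1 : ((i : ℤ) - j).toNat = i - j := by omega
  simp only [ipow, Int.toNat_natCast, h1]
  rw [hmain i j hj hij', hmain j j hj le_rfl, hWpow]
  simp
end

section
/- Let R be a standard graded Cohen–Macaulay k-algebra of dimension d ≥ 1 with canonical module ω and a-invariant a, J generated by a linear system of parameters. If J^i ω :_ω 𝔪^j = (J^i :_R 𝔪^j)·ω for some integers i ≥ j ≥ a + d, then for every l ≥ i: (a) J^l ω :_ω 𝔪^j = (J^l :_R 𝔪^j)·ω, and (b) J^l :_R 𝔪^j is integral over J^{l-i}(J^i :_R 𝔪^j). -/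
/-- Component projections of a graded module. -/
theorem exists_proj {k R ω : Type*} [Field k] [CommRing R] [Algebra k R]
    (𝒜 : ℤ → Submodule k R) [AddCommGroup ω] [Module R ω] [Module k ω]
    (w : ℤ → Submodule k ω) (hwint : DirectSum.IsInternal w)
    (hwsmul : ∀ (p q : ℤ), ∀ r ∈ 𝒜 p, ∀ x ∈ w q, r • x ∈ w (p + q)) :
    ∃ π : ℤ → ω →+ ω, (∀ p x, π p x ∈ w p) ∧ (∀ p, ∀ x ∈ w p, π p x = x) ∧
      (∀ p q, ∀ x ∈ w q, q ≠ p → π p x = 0) ∧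
      (∀ p q, ∀ r ∈ 𝒜 q, ∀ x, π (q + p) (r • x) = r • π p x) ∧
      (∀ (N : Submodule R ω) x, (∀ p, π p x ∈ N) → x ∈ N) := by
  classical
  let := hwint.chooseDecomposition
  refine ⟨fun p => AddMonoidHom.mk' (fun x => (DirectSum.decompose w x p : ω))
    (by intro x y; simp), ?_, ?_, ?_, ?_, ?_⟩
  · intro p x; exact (DirectSum.decompose w x p).2
  · intro p x hx; exact DirectSum.decompose_of_mem_same w hx
  · intro p q x hx hpq; exact DirectSum.decompose_of_mem_ne w hx hpq
  · intro p q r hr x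
    simp only [AddMonoidHom.mk'_apply]
    induction x using DirectSum.Decomposition.inductionOn w with
    | zero => simp
    | @homogeneous i m =>
      have hm := hwsmul q i r hr m m.2
      by_cases hip : i = p
      · subst hip
        rw [DirectSum.decompose_of_mem_same w hm, DirectSum.decompose_of_mem_same w m.2]
      · rw [DirectSum.decompose_of_mem_ne w hm (by omega),
          DirectSum.decompose_of_mem_ne w m.2 hip, smul_zero]
    | add m m' h1 h2 => simp only [smul_add, DirectSum.decompose_add, DirectSum.add_apply,
        Submodule.coe_add, h1, h2]
  · intro N x hx
    rw [← DirectSum.sum_support_decompose w x]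
    exact N.sum_mem fun p _ => hx p

/-- `span S • N` is homogeneous (with control of the shifts). -/
theorem proj_smul_mem {R ω : Type*} [CommRing R] [AddCommGroup ω] [Module R ω]
    (A : Set R) (q : ℤ) (π : ℤ → ω →+ ω)
    (h3 : ∀ p, ∀ r ∈ A, ∀ x, π (q + p) (r • x) = r • π p x)
    (N N' : Submodule R ω) (p : ℤ) (hN : ∀ x ∈ N, π p x ∈ N') (x : ω)
    (hx : x ∈ Ideal.span A • N) : π (q + p) x ∈ Ideal.span A • N' := by
  refine Submodule.smul_induction_on hx ?_ ?_
  · intro r hr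
    induction hr using Submodule.span_induction with
    | mem s hs =>
      intro n hn
      rw [h3 p s hs]
      exact Submodule.smul_mem_smul (Ideal.subset_span hs) (hN n hn)
    | zero => intro n hn; simp
    | add a b _ _ ha hb =>
      intro n hn
      rw [add_smul, map_add]
      exact Submodule.add_mem _ (ha n hn) (hb n hn)
    | smul c a _ ha =>
      intro n hn
      rw [smul_eq_mul, mul_comm, mul_smul]
      exact ha _ (N.smul_mem c hn)
  · intro a b ha hb
    rw [map_add]; exact Submodule.add_mem _ ha hb

open scoped Pointwise in
/-- Powers of `𝔪` are generated by forms of the right degree. -/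
theorem exists_pow_span {k R : Type*} [Field k] [CommRing R] [Algebra k R]
    (𝒜 : ℤ → Submodule k R) [GradedAlgebra 𝒜] (S : Set R) (c : ℤ) (hS : S ⊆ 𝒜 c) (t : ℕ) :
    ∃ T : Set R, T ⊆ 𝒜 (t * c) ∧ Ideal.span S ^ t = Ideal.span T := by
  induction t with
  | zero =>
    refine ⟨{1}, ?_, by simp⟩
    simpa using SetLike.GradedOne.one_mem (A := 𝒜)
  | succ t ih =>
    obtain ⟨T, hT, h⟩ := ih
    refine ⟨T * S, ?_, by rw [pow_succ, h, Ideal.span_mul_span']⟩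
    rintro _ ⟨u, hu, v, hv, rfl⟩
    have := SetLike.GradedMul.mul_mem (hT hu) (hS hv)
    have e : ((t + 1 : ℕ) : ℤ) * c = t * c + c := by push_cast; ring
    rw [e]; exact this

theorem sup_pow_le_aux {R : Type*} [CommRing R] (I I' T : Ideal R) (A B : ℕ)
    (h : ∀ r s : ℕ, r + s = A + B + 1 → (A + 1 ≤ r ∨ B + 1 ≤ s) → I ^ r * I' ^ s ≤ T) :
    (I ⊔ I') ^ (A + B + 1) ≤ T := by
  rw [← Submodule.add_eq_sup, add_pow, Ideal.sum_eq_sup]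
  refine Finset.sup_le fun m hm => ?_
  rw [Finset.mem_range] at hm
  exact Ideal.mul_le_left.trans (h m (A + B + 1 - m) (by omega) (by omega))

/-- Pigeonhole. -/
theorem pigeon {R ι : Type*} [CommRing R] (y : ι → R) (n : ℕ) (s : Finset ι) :
    Ideal.span (y '' s) ^ (s.card * n + 1) ≤ Ideal.span ((fun t => y t ^ (n + 1)) '' s) := by
  classical
  induction s using Finset.induction_on with
  | empty => simp
  | insert b s hb ih =>
    rw [Finset.card_insert_of_notMem hb, Finset.coe_insert, Set.image_insert_eq,
      Set.image_insert_eq, Ideal.span_insert, Ideal.span_insert,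
      show (s.card + 1) * n + 1 = n + s.card * n + 1 by ring]
    refine sup_pow_le_aux _ _ _ _ _ ?_
    rintro r u - (h | h)
    · refine Ideal.mul_le_left.trans (le_sup_of_le_left ?_)
      refine (Ideal.pow_le_pow_right h).trans ?_
      rw [Ideal.span_singleton_pow]
    · exact Ideal.mul_le_right.trans (le_sup_of_le_right ((Ideal.pow_le_pow_right h).trans ih))

theorem reduction_of_elements {R : Type*} [CommRing R] [IsNoetherianRing R] (K L : Ideal R)
    (hKL : K ≤ L) (h : ∀ x ∈ L, ∃ N : ℕ, x ^ (N + 1) ∈ K * L ^ N) :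
    ∃ n : ℕ, L ^ (n + 1) = K * L ^ n := by
  classical
  obtain ⟨s, hs⟩ := (isNoetherianRing_iff_ideal_fg R).1 ‹_› L
  have key : ∀ t : Finset R, (t : Set R) ⊆ L →
      ∃ n : ℕ, Ideal.span (t : Set R) ^ (n + 1) ≤ K * L ^ n := by
    intro t
    induction t using Finset.induction_on with
    | empty => intro _; exact ⟨0, by simp⟩
    | insert b t hb ih =>
      intro ht
      rw [Finset.coe_insert, Set.insert_subset_iff] at ht
      obtain ⟨B, hB⟩ := ih ht.2
      obtain ⟨A, hA⟩ := h b ht.1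
      refine ⟨A + B, ?_⟩
      rw [Finset.coe_insert, Ideal.span_insert]
      have hb' : Ideal.span {b} ≤ L := by
        rw [Ideal.span_singleton_le_iff_mem]; exact ht.1
      have ht' : Ideal.span (t : Set R) ≤ L := Ideal.span_le.2 ht.2
      have hA' : Ideal.span {b} ^ (A + 1) ≤ K * L ^ A := by
        rw [Ideal.span_singleton_pow, Ideal.span_singleton_le_iff_mem]; exact hA
      refine sup_pow_le_aux _ _ _ _ _ ?_
      rintro r u hru (h | h)
      · obtain ⟨c, rfl⟩ := Nat.exists_eq_add_of_le h
        rw [pow_add]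
        refine (Ideal.mul_mono (Ideal.mul_mono hA' (Ideal.pow_right_mono hb' c))
          (Ideal.pow_right_mono ht' u)).trans (le_of_eq ?_)
        rw [mul_assoc, mul_assoc, ← pow_add, ← pow_add]
        congr 2; omega
      · obtain ⟨c, rfl⟩ := Nat.exists_eq_add_of_le h
        rw [pow_add (Ideal.span (t : Set R))]
        refine (Ideal.mul_mono (Ideal.pow_right_mono hb' r)
          (Ideal.mul_mono hB (Ideal.pow_right_mono ht' c))).trans (le_of_eq ?_)
        rw [mul_assoc, mul_left_comm, ← pow_add, ← pow_add]
        congr 2; omega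
  obtain ⟨n, hn⟩ := key s (hs ▸ Ideal.subset_span)
  have hs' : Ideal.span (s : Set R) = L := hs
  rw [hs'] at hn
  refine ⟨n, le_antisymm hn ?_⟩
  rw [pow_succ']
  exact Ideal.mul_mono_left hKL

theorem det_trick {R ω : Type*} [CommRing R] [AddCommGroup ω] [Module R ω]
    [Module.Finite R ω] (hfaith : Module.annihilator R ω = ⊥) (K L : Ideal R) (hKL : K ≤ L)
    (h : L • (⊤ : Submodule R ω) ≤ K • ⊤) (x : R) (hx : x ∈ L) :
    ∃ N : ℕ, x ^ (N + 1) ∈ K * L ^ N := by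
  obtain ⟨p, hp, -, hc, h0⟩ :=
    LinearMap.exists_monic_and_natDegree_eq_and_coeff_mem_pow_and_aeval_eq_zero R
      (algebraMap R (Module.End R ω) x) K (by
        rintro _ ⟨z, rfl⟩
        exact h (Submodule.smul_mem_smul hx trivial))
  rw [Polynomial.aeval_algebraMap_apply] at h0
  have hpx : Polynomial.eval x p = 0 := by
    have : Polynomial.eval x p ∈ Module.annihilator R ω := by
      rw [Module.mem_annihilator]
      intro m
      have := LinearMap.congr_fun h0 m
      simpa [Polynomial.aeval_def] using this
    rw [hfaith] at this
    simpa using this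
  refine ⟨p.natDegree, ?_⟩
  rw [Polynomial.eval_eq_sum_range, Finset.sum_range_succ, hp.coeff_natDegree, one_mul] at hpx
  have e : x ^ (p.natDegree + 1)
      = -∑ m ∈ Finset.range p.natDegree, p.coeff m * x ^ m * x := by
    rw [← Finset.sum_mul, pow_succ]
    linear_combination x * hpx
  rw [e]
  refine neg_mem (Ideal.sum_mem _ fun m hm => ?_)
  rw [Finset.mem_range] at hm
  obtain ⟨c, hcm⟩ := Nat.exists_eq_add_of_lt hm
  have h1 := hc m
  rw [show p.natDegree - m = c + 1 by omega] at h1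
  rw [mul_assoc, ← pow_succ]
  have h2 := Ideal.mul_mem_mul h1 (Ideal.pow_mem_pow hx (m + 1))
  refine (?_ : K ^ (c + 1) * L ^ (m + 1) ≤ _) h2
  rw [pow_succ', mul_assoc]
  refine Ideal.mul_mono_right ?_
  refine (Ideal.mul_mono_left (Ideal.pow_right_mono hKL c)).trans (le_of_eq ?_)
  rw [← pow_add]; congr 1; omega

set_option maxHeartbeats 4000000 in

/-- **Corollary 2.4**: if `J^i ω :_ω 𝔪^j = (J^i :_R 𝔪^j)·ω` for some `i ≥ j ≥ a + d`, then
for every `l ≥ i`: (a) `J^l ω :_ω 𝔪^j = (J^l :_R 𝔪^j)·ω`, and (b) `J^l :_R 𝔪^j` is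
integral over `J^(l-i) (J^i :_R 𝔪^j)` (i.e. the latter is a reduction of the former). -/
theorem statement_4
    {k R : Type*} [Field k] [CommRing R] [Algebra k R] [IsNoetherianRing R]
    -- `R` is standard graded over `k`:
    (𝒜 : ℤ → Submodule k R) [GradedAlgebra 𝒜]
    (hneg : ∀ i : ℤ, i < 0 → 𝒜 i = ⊥)
    (hstd : ∀ i : ℤ, 0 ≤ i → 𝒜 (i + 1) = 𝒜 1 * 𝒜 i)
    -- of dimension `d ≥ 1`:
    (d : ℕ) (hd : 1 ≤ d) (hdim : ringKrullDim R = d)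
    -- `𝔪` is the homogeneous maximal ideal:
    (𝔪 : Ideal R) (h𝔪 : 𝔪 = Ideal.span (𝒜 1 : Set R))
    -- `y` is a linear system of parameters; its regularity encodes that `R` is Cohen–Macaulay:
    (y : Fin d → R) (hy1 : ∀ t, y t ∈ 𝒜 1)
    (hyreg : RingTheory.Sequence.IsRegular R (List.ofFn y))
    (J : Ideal R) (hJ : J = Ideal.span (Set.range y))
    (hsop : 𝔪 ≤ J.radical)
    -- the `a`-invariant (the negative of the initial degree of the canonical module `ω`):
    (a : ℤ) (ha : 0 ≤ a + d)
    -- `J` is a reduction of `𝔪` with reduction number `a + d`: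
    (hred : ∀ n : ℤ, a + d ≤ n → ipow 𝔪 (n + 1) = J * ipow 𝔪 n)
    -- `ω` is the graded canonical module of `R`: a finitely generated faithful graded
    -- maximal Cohen–Macaulay module with initial degree `-a`, generated in degrees `≤ d`,
    -- whose Artinian reductions `ω/J^{[n]}ω` have socle concentrated in degree `n·d`:
    {ω : Type*} [AddCommGroup ω] [Module R ω] [Module k ω] [IsScalarTower k R ω]
    (w : ℤ → Submodule k ω)
    (hwint : DirectSum.IsInternal w)
    (hwsmul : ∀ (p q : ℤ), ∀ r ∈ 𝒜 p, ∀ x ∈ w q, r • x ∈ w (p + q))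
    [Module.Finite R ω]
    (hfaith : Module.annihilator R ω = ⊥)
    (hbelow : ∀ p : ℤ, p < -a → w p = ⊥)
    (hinit : w (-a) ≠ ⊥)
    (hgend : Submodule.span R (⋃ p : ℤ, ⋃ (_ : p ≤ (d : ℤ)), (w p : Set ω)) = ⊤)
    (hregw : RingTheory.Sequence.IsRegular ω (List.ofFn y))
    (hsoc : ∀ n : ℕ, ∀ x : ω,
      (∀ m ∈ 𝔪, m • x ∈ (Ideal.span (Set.range fun t => y t ^ n)) • (⊤ : Submodule R ω)) →
      ∃ u ∈ (Ideal.span (Set.range fun t => y t ^ n)) • (⊤ : Submodule R ω),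
        ∃ v ∈ w ((n : ℤ) * d), x = u + v)
    (i j : ℤ) (hj : a + d ≤ j) (hij : j ≤ i)
    (h : mcolon ((ipow J i) • (⊤ : Submodule R ω)) (ipow 𝔪 j)
        = (Submodule.colon (ipow J i) (ipow 𝔪 j)) • (⊤ : Submodule R ω))
    (l : ℤ) (hl : i ≤ l) :
    mcolon ((ipow J l) • (⊤ : Submodule R ω)) (ipow 𝔪 j)
        = (Submodule.colon (ipow J l) (ipow 𝔪 j)) • (⊤ : Submodule R ω)
    ∧ ∃ n : ℕ, (Submodule.colon (ipow J l) (ipow 𝔪 j)) ^ (n + 1)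
        = (ipow J (l - i) * Submodule.colon (ipow J i) (ipow 𝔪 j))
            * (Submodule.colon (ipow J l) (ipow 𝔪 j)) ^ n := by
  obtain ⟨π, π0, π1, π2, π3, π5⟩ := exists_proj 𝒜 w hwint hwsmul
  lift j to ℕ using ha.trans hj
  lift i to ℕ using (Int.natCast_nonneg j).trans hij
  lift l to ℕ using (Int.natCast_nonneg i).trans hl
  obtain ⟨e, rfl⟩ := Nat.exists_eq_add_of_le (Int.ofNat_le.1 hl)
  have hij' : j ≤ i := by exact_mod_cast hij
  have hei : (((i + e : ℕ) : ℤ) - (i : ℤ)).toNat = e := by omega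
  simp only [ipow, Int.toNat_natCast, hei] at h ⊢
  have hred' : ∀ n : ℕ, j ≤ n → 𝔪 ^ (n + 1) = J * 𝔪 ^ n := by
    intro n hn
    have := hred n (by omega)
    simpa only [ipow, Int.toNat_natCast, show ((n : ℤ) + 1).toNat = n + 1 by omega] using this
  have hpow : ∀ s : ℕ, 𝔪 ^ (j + s) = J ^ s * 𝔪 ^ j := by
    intro s
    induction s with
    | zero => simp
    | succ s ih => rw [← add_assoc, hred' _ (by omega), ih, pow_succ', mul_assoc]
  have h𝔪pow : ∀ t : ℕ, ∃ T : Set R, T ⊆ 𝒜 t ∧ 𝔪 ^ t = Ideal.span T := by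
    intro t
    have := exists_pow_span 𝒜 (𝒜 1 : Set R) 1 le_rfl t
    rwa [mul_one, ← h𝔪] at this
  have hyA : Set.range y ⊆ 𝒜 1 := by rintro _ ⟨t, rfl⟩; exact hy1 t
  have hJpow : ∀ t : ℕ, ∃ T : Set R, T ⊆ 𝒜 t ∧ J ^ t = Ideal.span T := by
    intro t
    have := exists_pow_span 𝒜 (Set.range y) 1 hyA t
    rwa [mul_one, ← hJ] at this
  have hJm : J ≤ 𝔪 := by rw [hJ, h𝔪]; exact Ideal.span_mono hyA
  have hhom : ∀ (A : Set R) (q : ℤ), A ⊆ 𝒜 q → ∀ (N' : Submodule R ω) (p : ℤ),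
      (∀ x, π (p - q) x ∈ N') → ∀ x ∈ Ideal.span A • (⊤ : Submodule R ω),
      π p x ∈ Ideal.span A • N' := by
    intro A q hA N' p hN x hx
    have := proj_smul_mem A q π (fun p r hr x => π3 p q r (hA hr) x) ⊤ N' (p - q)
      (fun x _ => hN x) x hx
    rwa [add_sub_cancel] at this
  have hQA : ∀ n : ℕ, (Set.range fun t => y t ^ n) ⊆ (𝒜 n : Set R) := by
    rintro n _ ⟨t, rfl⟩
    have := SetLike.pow_mem_graded n (hy1 t)
    simpa using this
  have hQ : ∀ n : ℕ, J ^ (d * n + 1) ≤ Ideal.span (Set.range fun t => y t ^ (n + 1)) := by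
    intro n
    have := pigeon y n Finset.univ
    simpa [← hJ] using this
  have hJhom : ∀ (t : ℕ) (p : ℤ), ∀ x ∈ J ^ t • (⊤ : Submodule R ω), π p x ∈ J ^ t • (⊤ : Submodule R ω) := by
    intro t p x hx
    obtain ⟨T, hT, hJT⟩ := hJpow t
    rw [hJT] at hx ⊢
    exact hhom T t hT ⊤ p (fun _ => trivial) x hx
  -- the socle lemma
  have soc : ∀ (n : ℕ) (p : ℤ) (x : ω), x ∈ w p →
      x ∉ Ideal.span (Set.range fun t => y t ^ (n + 1)) • (⊤ : Submodule R ω) →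
      ∃ t : ℕ, (t : ℤ) + p = ((n + 1 : ℕ) : ℤ) * d ∧ ∃ r ∈ 𝔪 ^ t,
        r • x ∉ Ideal.span (Set.range fun t => y t ^ (n + 1)) • (⊤ : Submodule R ω) := by
    intro n p x hx hxQ
    set Q := Ideal.span (Set.range fun t => y t ^ (n + 1)) with hQdef
    classical
    have hex : ∃ T : ℕ, ∀ r ∈ 𝔪 ^ T, r • x ∈ Q • (⊤ : Submodule R ω) := by
      refine ⟨j + (d * n + 1), fun r hr => ?_⟩
      rw [hpow] at hr
      exact Submodule.smul_mem_smul (hQ n (Ideal.mul_le_left hr)) trivial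
    obtain ⟨t, ht⟩ : ∃ t, Nat.find hex = t + 1 := by
      refine Nat.exists_eq_succ_of_ne_zero fun h0 => hxQ ?_
      have := Nat.find_spec hex
      rw [h0] at this
      simpa using this 1 (by simp)
    have h1 := Nat.find_spec hex
    have h2 := Nat.find_min hex (m := t) (by omega)
    rw [ht] at h1
    obtain ⟨S, hS, hSt⟩ := h𝔪pow t
    have h3 : ∃ s ∈ S, s • x ∉ Q • (⊤ : Submodule R ω) := by
      by_contra! hcon
      refine h2 fun r hr => ?_
      rw [hSt] at hr
      induction hr using Submodule.span_induction with
      | mem s hs => exact hcon s hs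
      | zero => simp
      | add a b _ _ ha hb => rw [add_smul]; exact Submodule.add_mem _ ha hb
      | smul c b _ hb => rw [smul_assoc]; exact Submodule.smul_mem _ c hb
    obtain ⟨s, hs, hsx⟩ := h3
    have hst : s ∈ 𝔪 ^ t := by rw [hSt]; exact Ideal.subset_span hs
    refine ⟨t, ?_, s, hst, hsx⟩
    by_contra hne
    obtain ⟨u, hu, v, hv, huv⟩ := hsoc (n + 1) (s • x) (by
      intro m hm
      rw [← mul_smul]
      refine h1 _ ?_
      rw [pow_succ']
      exact Ideal.mul_mem_mul hm hst)
    refine hsx ?_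
    have hsw := hwsmul t p s (hS hs) x hx
    rw [← π1 _ _ hsw, huv, map_add, π2 _ _ v hv (fun hh => hne hh.symm), add_zero]
    exact hhom _ _ (hQA (n + 1)) ⊤ _ (fun _ => trivial) u hu
  -- vanishing in low degrees
  have low : ∀ (l : ℕ) (p : ℤ) (x : ω), x ∈ w p → p < l + d - j →
      (∀ r ∈ 𝔪 ^ j, r • x ∈ J ^ l • (⊤ : Submodule R ω)) → x = 0 := by
    intro l p x hx hp hxJ
    by_contra hx0
    obtain ⟨n, hn1, hn2⟩ : ∃ n : ℕ, p + a < n + 1 ∧ p + j ≤ n + 1 :=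
      ⟨(max (p + a) (p + j)).toNat, by omega, by omega⟩
    obtain ⟨t, htp, r, hr, hrx⟩ := soc n p x hx (by
      intro hxQ
      have := hhom _ _ (hQA (n + 1)) ⊥ p (fun z => by
        have hz := π0 (p - ((n + 1 : ℕ) : ℤ)) z
        rw [hbelow _ (by push_cast; omega)] at hz
        simpa using hz) x hxQ
      rw [π1 p x hx, Submodule.smul_bot] at this
      exact hx0 (by simpa using this))
    have hd' : (1 : ℤ) ≤ d := by exact_mod_cast hd
    push_cast at htp
    have htj : (j : ℤ) ≤ t := by nlinarith
    obtain ⟨s, rfl⟩ := Nat.exists_eq_add_of_le (Int.ofNat_le.1 htj)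
    have hsl : d * n + 1 ≤ s + l := by
      zify
      push_cast at htp
      nlinarith
    refine hrx ?_
    have hmem : r • x ∈ J ^ s • (J ^ l • (⊤ : Submodule R ω)) := by
      rw [hpow] at hr
      refine Submodule.mul_induction_on hr ?_ ?_
      · intro b hb c hc
        rw [mul_smul]
        exact Submodule.smul_mem_smul hb (hxJ c hc)
      · intro b c hb hc
        rw [add_smul]; exact Submodule.add_mem _ hb hc
    rw [← Submodule.mul_smul, ← pow_add] at hmem
    exact Submodule.smul_mono_left ((Ideal.pow_le_pow_right hsl).trans (hQ n)) hmem
  -- truncations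
  let W : ℤ → Submodule R ω := fun q => Submodule.span R {x | ∃ p, q ≤ p ∧ x ∈ w p}
  have Wstep : ∀ q : ℤ, (d : ℤ) ≤ q → W (q + 1) ≤ J • W q := by
    intro q hq
    refine Submodule.span_le.2 ?_
    rintro x ⟨p, hp, hx⟩
    have hxJ : x ∈ J • (⊤ : Submodule R ω) := by
      by_contra hcon
      obtain ⟨t, ht, -⟩ := soc 0 p x hx (by simpa [← hJ] using hcon)
      push_cast at ht
      omega
    rw [hJ] at hxJ ⊢
    have := hhom _ 1 hyA (W q) p (fun z => Submodule.subset_span ⟨p - 1, by omega, π0 _ z⟩) x hxJ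
    rwa [π1 p x hx] at this
  have Wpow : ∀ (q : ℤ), (d : ℤ) ≤ q → ∀ s : ℕ, W (q + s) ≤ J ^ s • W q := by
    intro q hq s
    induction s with
    | zero => simp
    | succ s ih =>
      rw [pow_succ', Submodule.mul_smul]
      push_cast
      rw [← add_assoc]
      exact (Wstep _ (by omega)).trans (Submodule.smul_mono le_rfl ih)
  have Wup : ∀ q : ℤ, 𝔪 ^ j • W q ≤ W (q + j) := by
    intro q
    obtain ⟨T, hT, hmT⟩ := h𝔪pow j
    rw [hmT]
    simp only [W, Ideal.span]
    rw [Submodule.span_smul_span, Submodule.span_le]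
    intro z hz
    simp only [Set.mem_smul, Set.mem_ofPred_eq] at hz
    obtain ⟨s, hs, x, ⟨p, hp, hx⟩, rfl⟩ := hz
    exact Submodule.subset_span ⟨j + p, by omega, hwsmul _ _ s (hT hs) x hx⟩
  have hlow : ∀ l : ℕ, mcolon (J ^ l • (⊤ : Submodule R ω)) (𝔪 ^ j) ≤ W (l + d - j) := by
    intro l x hx
    refine π5 _ x fun p => ?_
    by_cases hp : p < l + d - j
    · have : π p x = 0 := by
        refine low l p _ (π0 p x) hp fun r hr => ?_
        obtain ⟨T, hT, hmT⟩ := h𝔪pow j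
        rw [hmT] at hr
        induction hr using Submodule.span_induction with
        | mem s hs =>
          rw [← π3 p j s (hT hs) x]
          refine hJhom l _ _ (hx s ?_)
          rw [hmT]; exact Ideal.subset_span hs
        | zero => simp
        | add a b _ _ ha hb => rw [add_smul]; exact Submodule.add_mem _ ha hb
        | smul c b _ hb => rw [smul_assoc]; exact Submodule.smul_mem _ c hb
      rw [this]; exact zero_mem _
    · exact Submodule.subset_span ⟨p, by omega, π0 p x⟩
  have hup : W (i + d - j) ≤ mcolon (J ^ i • (⊤ : Submodule R ω)) (𝔪 ^ j) := by
    intro x hx r hr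
    have h1 := Wup _ (Submodule.smul_mem_smul hr hx)
    rw [show (i : ℤ) + d - j + j = d + i by ring] at h1
    exact Submodule.smul_mono le_rfl le_top (Wpow d le_rfl i h1)
  set Ci := Submodule.colon (J ^ i) ((𝔪 ^ j : Ideal R) : Set R) with hCi
  set Cl := Submodule.colon (J ^ (i + e)) ((𝔪 ^ j : Ideal R) : Set R) with hCl
  have hKL : J ^ e * Ci ≤ Cl := by
    refine Ideal.mul_le.2 fun b hb c hc => ?_
    rw [hCl, Submodule.mem_colon]
    intro s hs
    rw [smul_eq_mul, mul_assoc, add_comm, pow_add]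
    exact Ideal.mul_mem_mul hb (Submodule.mem_colon.1 hc s hs)
  have hA : mcolon (J ^ (i + e) • (⊤ : Submodule R ω)) (𝔪 ^ j) ≤ (J ^ e * Ci) • ⊤ := by
    refine (hlow _).trans ?_
    rw [show (((i + e : ℕ) : ℤ) + d - j) = (i + d - j) + (e : ℕ) by push_cast; ring]
    refine (Wpow _ (by omega) e).trans ?_
    rw [Submodule.mul_smul, ← h]
    exact Submodule.smul_mono le_rfl hup
  have hB : Cl • (⊤ : Submodule R ω) ≤ mcolon (J ^ (i + e) • (⊤ : Submodule R ω)) (𝔪 ^ j) := by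
    refine Submodule.smul_le.2 fun b hb x _ r hr => ?_
    rw [← mul_smul, mul_comm]
    exact Submodule.smul_mem_smul (Submodule.mem_colon.1 hb r hr) trivial
  refine ⟨le_antisymm (hA.trans (Submodule.smul_mono_left hKL)) hB, ?_⟩
  exact reduction_of_elements _ _ hKL (det_trick hfaith _ _ hKL (hB.trans hA))
end

section
/- Let R be a standard graded Cohen–Macaulay k-algebra of dimension d and H a homogeneous R-ideal. Writing c = c(R) for the negative of the largest generator degree of the canonical module ω, one has indeg(0 : H) ≥ c + d + 1 - e(R/H), where e(R/H) is the multiplicity of R/H and indeg denotes the initial degree of a nonzero homogeneous ideal. -/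
section
open DirectSum

theorem hs_comp_left {k R : Type*} [Field k] [CommRing R] [Algebra k R]
    (𝒜 : ℤ → Submodule k R) [GradedAlgebra 𝒜] {i : ℤ} {a : R} (ha : a ∈ 𝒜 i) (b : R) (p : ℤ) :
    (decompose 𝒜 (a * b) p : R) = a * decompose 𝒜 b (p - i) := by
  have := coe_decompose_mul_add_of_left_mem 𝒜 (j := p - i) (b := b) ha
  rwa [add_sub_cancel] at this

theorem hs_mem_of_comp {k R : Type*} [Field k] [CommRing R] [Algebra k R]
    (𝒜 : ℤ → Submodule k R) [GradedAlgebra 𝒜] (I : Ideal R) (u : R)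
    (h : ∀ p, (decompose 𝒜 u p : R) ∈ I) : u ∈ I := by
  classical
  rw [← DirectSum.sum_support_decompose 𝒜 u]
  exact Ideal.sum_mem _ fun p _ => h p

theorem hs_comp_neg {k R : Type*} [Field k] [CommRing R] [Algebra k R]
    (𝒜 : ℤ → Submodule k R) [GradedAlgebra 𝒜]
    (hneg : ∀ i : ℤ, i < 0 → 𝒜 i = ⊥) (r : R) (p : ℤ) (hp : p < 0) :
    (decompose 𝒜 r p : R) = 0 := by
  have h1 : ∀ z ∈ 𝒜 p, z = 0 := by
    intro z hz
    rwa [hneg p hp, Submodule.mem_bot] at hz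
  exact h1 _ (decompose 𝒜 r p).2

/-- torsion-freeness over the polynomial ring in the regular sequence -/
theorem hs_torsion {k R : Type*} [Field k] [CommRing R] [Algebra k R]
    (𝒜 : ℤ → Submodule k R) [GradedAlgebra 𝒜]
    (hneg : ∀ i : ℤ, i < 0 → 𝒜 i = ⊥) (n : ℕ) :
    ∀ (y : Fin n → R) (_ : ∀ t, y t ∈ 𝒜 1) (I : Ideal R) (_ : I.IsHomogeneous 𝒜)
      (_ : ∀ t : Fin n, ∀ r : R, y t * r ∈ I ⊔ Ideal.span (y '' {j | j < t}) →
        r ∈ I ⊔ Ideal.span (y '' {j | j < t}))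
      (f : MvPolynomial (Fin n) k) (_ : f ≠ 0) (r : R),
      MvPolynomial.aeval y f * r ∈ I → r ∈ I := by
  induction n with
  | zero =>
    intro y _ I _ _ f hf r hr
    obtain ⟨c, rfl⟩ := MvPolynomial.C_surjective (R := k) (Fin 0) f
    have hc : c ≠ 0 := by rintro rfl; simp at hf
    rw [MvPolynomial.aeval_C] at hr
    have := I.mul_mem_left (algebraMap k R c⁻¹) hr
    rwa [← mul_assoc, ← map_mul, inv_mul_cancel₀ hc, map_one, one_mul] at this
  | succ n ih =>
    intro y hy I hI hreg f hf r hr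
    set I' : Ideal R := I ⊔ Ideal.span {y 0} with hI'
    have hI'h : I'.IsHomogeneous 𝒜 := by
      apply Ideal.IsHomogeneous.sup hI
      apply Ideal.homogeneous_span
      rintro z rfl
      exact ⟨1, hy 0⟩
    have key := ih (fun t => y t.succ) (fun t => hy _) I' hI'h (by
      intro t r h
      have e : I' ⊔ Ideal.span ((fun t => y t.succ) '' {j | j < t}) =
          I ⊔ Ideal.span (y '' {j | j < t.succ}) := by
        rw [hI', sup_assoc, ← Ideal.span_union]
        congr 2
        ext z
        simp only [Set.mem_union, Set.mem_singleton_iff, Set.mem_image, Set.mem_ofPred_eq]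
        constructor
        · rintro (rfl | ⟨j, hj, rfl⟩)
          · exact ⟨0, Fin.succ_pos t, rfl⟩
          · exact ⟨j.succ, Fin.succ_lt_succ_iff.mpr hj, rfl⟩
        · rintro ⟨j, hj, rfl⟩
          rcases Fin.eq_zero_or_eq_succ j with rfl | ⟨j, rfl⟩
          · exact Or.inl rfl
          · exact Or.inr ⟨j, Fin.succ_lt_succ_iff.mp hj, rfl⟩
      rw [e] at h ⊢
      exact hreg t.succ r h)
    have hreg0 : ∀ r : R, y 0 * r ∈ I → r ∈ I := by
      intro r h
      have := hreg 0 r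
      simpa using this (by simpa using h)
    -- evaluation of polynomials
    let ψ : Polynomial (MvPolynomial (Fin n) k) → R := fun p =>
      MvPolynomial.aeval y ((MvPolynomial.finSuccEquiv k n).symm p)
    have hψmul : ∀ p q, ψ (p * q) = ψ p * ψ q := fun p q => by simp [ψ]
    have hψadd : ∀ p q, ψ (p + q) = ψ p + ψ q := fun p q => by simp [ψ]
    have hψX : ψ Polynomial.X = y 0 := by
      have : (MvPolynomial.finSuccEquiv k n).symm Polynomial.X = MvPolynomial.X 0 := by
        rw [AlgEquiv.symm_apply_eq, MvPolynomial.finSuccEquiv_X_zero]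
      simp [ψ, this]
    have hψC : ∀ g, ψ (Polynomial.C g) = MvPolynomial.aeval (fun t => y (Fin.succ t)) g := by
      intro g
      have : (MvPolynomial.finSuccEquiv k n).symm (Polynomial.C g) =
          MvPolynomial.rename Fin.succ g := by
        rw [AlgEquiv.symm_apply_eq]
        induction g using MvPolynomial.induction_on with
        | C a => simp [MvPolynomial.finSuccEquiv_apply]
        | add p q hp hq => rw [map_add, map_add, map_add, hp, hq]
        | mul_X p i hp => rw [map_mul, map_mul, map_mul, hp, MvPolynomial.rename_X,
            MvPolynomial.finSuccEquiv_X_succ]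
      simp only [ψ, this, MvPolynomial.aeval_rename]
      rfl
    -- case of nonzero constant coefficient
    have main : ∀ p : Polynomial (MvPolynomial (Fin n) k), p.coeff 0 ≠ 0 → ∀ r : R,
        ψ p * r ∈ I → r ∈ I := by
      intro p hp r hr
      have step : ∀ r : R, ψ p * r ∈ I → ∃ r', ψ p * r' ∈ I ∧ r - y 0 * r' ∈ I := by
        intro r hr
        have h1 : ψ p = y 0 * ψ p.divX + MvPolynomial.aeval (fun t => y (Fin.succ t)) (p.coeff 0) := by
          conv_lhs => rw [← Polynomial.X_mul_divX_add p]
          rw [hψadd, hψmul, hψX, hψC]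
        have h2 : r ∈ I' := by
          apply key _ hp
          have : MvPolynomial.aeval (fun t => y (Fin.succ t)) (p.coeff 0) * r =
            ψ p * r + y 0 * (- (ψ p.divX * r)) := by rw [h1]; ring
          rw [this]
          exact Ideal.add_mem _ (Ideal.mem_sup_left hr)
            (Ideal.mem_sup_right (Ideal.mul_mem_right _ _ (Ideal.mem_span_singleton_self _)))
        obtain ⟨u, hu, v, hv, rfl⟩ := Submodule.mem_sup.mp h2
        obtain ⟨r', rfl⟩ := Ideal.mem_span_singleton'.mp hv
        refine ⟨r', hreg0 _ ?_, by convert hu using 1; ring⟩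
        have : y 0 * (ψ p * r') = ψ p * (u + r' * y 0) - ψ p * u := by ring
        rw [this]
        exact Ideal.sub_mem _ hr (I.mul_mem_left _ hu)
      have all : ∀ j : ℕ, ∃ r', ψ p * r' ∈ I ∧ r - y 0 ^ j * r' ∈ I := by
        intro j
        induction j with
        | zero => exact ⟨r, hr, by simp⟩
        | succ j ihj =>
          obtain ⟨r', h1, h2⟩ := ihj
          obtain ⟨r'', h3, h4⟩ := step r' h1
          refine ⟨r'', h3, ?_⟩
          have : r - y 0 ^ (j+1) * r'' = (r - y 0 ^ j * r') + y 0 ^ j * (r' - y 0 * r'') := by ring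
          rw [this]
          exact I.add_mem h2 (I.mul_mem_left _ h4)
      apply hs_mem_of_comp 𝒜
      intro q
      obtain ⟨r', -, h⟩ := all (q.toNat + 1)
      have h2 := hI q h
      have hyp : y 0 ^ (q.toNat + 1) ∈ 𝒜 ((q.toNat + 1 : ℕ) : ℤ) := by
        have := SetLike.pow_mem_graded (q.toNat + 1) (hy 0)
        simpa using this
      have h3 : (decompose 𝒜 r' (q - ((q.toNat + 1 : ℕ) : ℤ)) : R) = 0 := by
        exact hs_comp_neg 𝒜 hneg r' _ (by push_cast; have := Int.self_le_toNat q; linarith)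
      rw [decompose_sub, DirectSum.sub_apply, AddSubgroupClass.coe_sub, hs_comp_left 𝒜 hyp, h3,
        mul_zero, sub_zero] at h2
      exact h2
    -- general case
    have gen : ∀ N : ℕ, ∀ p : Polynomial (MvPolynomial (Fin n) k), p.natDegree ≤ N → p ≠ 0 →
        ∀ r : R, ψ p * r ∈ I → r ∈ I := by
      intro N
      induction N with
      | zero =>
        intro p hp hp0 r hr
        refine main p (fun h => hp0 ?_) r hr
        rw [Polynomial.eq_C_of_natDegree_le_zero hp, h, map_zero]
      | succ N ihN =>
        intro p hp hp0 r hr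
        by_cases h0 : p.coeff 0 = 0
        · have e : p = Polynomial.X * p.divX := by
            conv_lhs => rw [← Polynomial.X_mul_divX_add p]
            rw [h0, map_zero, add_zero]
          refine ihN p.divX ?_ ?_ r (hreg0 _ ?_)
          · rw [Polynomial.natDegree_divX_eq_natDegree_tsub_one]; omega
          · intro h; rw [h, mul_zero] at e; exact hp0 e
          · rw [← mul_assoc, ← hψX, ← hψmul, ← e]; exact hr
        · exact main p h0 r hr
    refine gen _ (MvPolynomial.finSuccEquiv k n f) le_rfl (by simpa using hf) r ?_
    simpa [ψ] using hr

theorem hs_fact (δ n : ℕ) : ∀ m : ℕ, δ + m ≤ n → (δ + m).factorial ≤ δ.factorial * n ^ m := by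
  intro m
  induction m with
  | zero => intro _; simp
  | succ m ih =>
    intro h
    rw [← add_assoc, Nat.factorial_succ, pow_succ, ← mul_assoc, mul_comm (δ + m + 1)]
    exact Nat.mul_le_mul (ih (by omega)) (by omega)

theorem hs_count (k : Type*) [Field k] (d m : ℕ) :
    m ^ d ≤ d.factorial * Module.finrank k (MvPolynomial.restrictTotalDegree (Fin d) k m) := by
  classical
  have h1 : Fintype.card (Sym (Fin (d+1)) m) ≤
      Module.finrank k (MvPolynomial.restrictTotalDegree (Fin d) k m) := by
    let b := MvPolynomial.basisRestrictSupport k {n : Fin d →₀ ℕ | n.degree ≤ m}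
    have : Module.Finite k (MvPolynomial.restrictTotalDegree (Fin d) k m) := inferInstance
    have : Module.Finite k (MvPolynomial.restrictSupport k {n : Fin d →₀ ℕ | n.degree ≤ m}) := this
    have hfin : Finite {n : Fin d →₀ ℕ | n.degree ≤ m} := Module.Finite.finite_basis b
    have e : Module.finrank k (MvPolynomial.restrictTotalDegree (Fin d) k m) =
      Nat.card {n : Fin d →₀ ℕ | n.degree ≤ m} := Module.finrank_eq_nat_card_basis b
    rw [e, ← Nat.card_eq_fintype_card]
    have E := Sym.equivNatSumOfFintype (Fin (d+1)) m
    rw [Nat.card_congr E]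
    refine Nat.card_le_card_of_injective
      (fun P => ⟨Finsupp.equivFunOnFinite.symm (fun t : Fin d => P.1 t.succ), ?_⟩) ?_
    · have := P.2
      rw [Fin.sum_univ_succ] at this
      simp only [Set.mem_ofPred_eq, Finsupp.degree_eq_sum]
      simp
      omega
    · intro P Q h
      have h' : ∀ t : Fin d, P.1 t.succ = Q.1 t.succ := by
        intro t
        have := congrArg (fun z => z.1 t) h
        simpa using this
      ext t
      rcases Fin.eq_zero_or_eq_succ t with rfl | ⟨t, rfl⟩
      · have hP := P.2
        have hQ := Q.2
        rw [Fin.sum_univ_succ] at hP hQ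
        rw [Finset.sum_congr rfl fun t _ => h' t] at hP
        omega
      · exact h' t
  refine le_trans ?_ (Nat.mul_le_mul_left _ h1)
  rw [Sym.card_sym_eq_choose, Fintype.card_fin, show d + 1 + m - 1 = m + d by omega,
    Nat.choose_symm_add, ← Nat.ascFactorial_eq_factorial_mul_choose]
  exact le_trans (Nat.pow_le_pow_left (Nat.le_succ m) d) (Nat.pow_succ_le_ascFactorial _ _)

theorem hs_regular {R : Type*} [CommRing R] {d : ℕ} (y : Fin d → R)
    (hyreg : RingTheory.Sequence.IsRegular R (List.ofFn y)) (t : Fin d) (r : R)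
    (h : y t * r ∈ (⊥ : Ideal R) ⊔ Ideal.span (y '' {j | j < t})) :
    r ∈ (⊥ : Ideal R) ⊔ Ideal.span (y '' {j | j < t}) := by
  have h1 := hyreg.toIsWeaklyRegular.regular_mod_prev t (by simp)
  have e : (Ideal.ofList ((List.ofFn y).take t) • ⊤ : Submodule R R) =
      (⊥ : Ideal R) ⊔ Ideal.span (y '' {j | j < t}) := by
    rw [bot_sup_eq, smul_eq_mul, Ideal.mul_top, Ideal.ofList]
    congr 1
    ext z
    simp only [Set.mem_ofPred_eq, List.mem_take_iff_getElem, Set.mem_image]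
    constructor
    · rintro ⟨i, hi, rfl⟩
      simp only [List.length_ofFn, lt_inf_iff] at hi
      exact ⟨⟨i, hi.2⟩, hi.1, by simp⟩
    · rintro ⟨j, hj, rfl⟩
      refine ⟨j, by simpa using hj, by simp⟩
  rw [← e] at h ⊢
  rw [← Submodule.Quotient.mk_eq_zero] at h ⊢
  apply h1
  simp only [List.getElem_ofFn, smul_zero]
  exact h

theorem hs_tf {k R : Type*} [Field k] [CommRing R] [Algebra k R]
    (𝒜 : ℤ → Submodule k R) [GradedAlgebra 𝒜]
    (hneg : ∀ i : ℤ, i < 0 → 𝒜 i = ⊥) {d : ℕ}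
    (y : Fin d → R) (hy1 : ∀ t, y t ∈ 𝒜 1)
    (hyreg : RingTheory.Sequence.IsRegular R (List.ofFn y))
    (f : MvPolynomial (Fin d) k) (hf : f ≠ 0) (r : R) (h : MvPolynomial.aeval y f * r = 0) :
    r = 0 :=
  hs_torsion 𝒜 hneg d y hy1 ⊥ (Ideal.IsHomogeneous.bot 𝒜) (hs_regular y hyreg) f hf r
    (by rw [h]; exact Ideal.zero_mem _)

/-- the span over `k[y]` of the `r * x`, `r` of degree at most `j` -/
def hsSp {k R : Type*} [Field k] [CommRing R] [Algebra k R]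
    (𝒜 : ℤ → Submodule k R) {d : ℕ} (y : Fin d → R) (x : R) (j : ℤ) : Submodule k R :=
  Submodule.span k {m | ∃ s : MvPolynomial (Fin d) k, ∃ p ≤ j, ∃ r ∈ 𝒜 p,
    m = MvPolynomial.aeval y s * (r * x)}

/-- the saturation of `hsSp` -/
def hsT {k R : Type*} [Field k] [CommRing R] [Algebra k R]
    (𝒜 : ℤ → Submodule k R) {d : ℕ} (y : Fin d → R) (x : R) (j : ℤ) (m : R) : Prop :=
  ∃ f : MvPolynomial (Fin d) k, f ≠ 0 ∧ MvPolynomial.aeval y f * m ∈ hsSp 𝒜 y x j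

section
variable {k R : Type*} [Field k] [CommRing R] [Algebra k R]
    (𝒜 : ℤ → Submodule k R) {d : ℕ} (y : Fin d → R) (x : R)

theorem hsSp_mul (s : MvPolynomial (Fin d) k) (j : ℤ) (m : R) (hm : m ∈ hsSp 𝒜 y x j) :
    MvPolynomial.aeval y s * m ∈ hsSp 𝒜 y x j := by
  induction hm using Submodule.span_induction with
  | mem m hm =>
    obtain ⟨s', p, hp, r, hr, rfl⟩ := hm
    refine Submodule.subset_span ⟨s * s', p, hp, r, hr, ?_⟩
    rw [map_mul, mul_assoc]
  | zero => simp
  | add a b _ _ ha hb => rw [mul_add]; exact add_mem ha hb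
  | smul c a _ ha => rw [mul_smul_comm]; exact Submodule.smul_mem _ _ ha

theorem hsSp_gen (j p : ℤ) (hp : p ≤ j) (r : R) (hr : r ∈ 𝒜 p) : r * x ∈ hsSp 𝒜 y x j :=
  Submodule.subset_span ⟨1, p, hp, r, hr, by simp⟩

theorem hsSp_deg [GradedAlgebra 𝒜] (j : ℤ) (l m : R) (hl : l ∈ 𝒜 1) (hm : m ∈ hsSp 𝒜 y x j) :
    l * m ∈ hsSp 𝒜 y x (j + 1) := by
  induction hm using Submodule.span_induction with
  | mem m hm =>
    obtain ⟨s', p, hp, r, hr, rfl⟩ := hm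
    refine Submodule.subset_span ⟨s', 1 + p, by omega, l * r, SetLike.mul_mem_graded hl hr, ?_⟩
    ring
  | zero => simp
  | add a b _ _ ha hb => rw [mul_add]; exact add_mem ha hb
  | smul c a _ ha => rw [mul_smul_comm]; exact Submodule.smul_mem _ _ ha

theorem hsT_of_mem (j : ℤ) (m : R) (hm : m ∈ hsSp 𝒜 y x j) : hsT 𝒜 y x j m :=
  ⟨1, one_ne_zero, by simpa using hm⟩

theorem hsT_add (j : ℤ) (m m' : R) (hm : hsT 𝒜 y x j m) (hm' : hsT 𝒜 y x j m') :
    hsT 𝒜 y x j (m + m') := by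
  obtain ⟨f, hf, h⟩ := hm
  obtain ⟨g, hg, h'⟩ := hm'
  refine ⟨f * g, mul_ne_zero hf hg, ?_⟩
  have : MvPolynomial.aeval y (f * g) * (m + m') =
      MvPolynomial.aeval y g * (MvPolynomial.aeval y f * m) +
      MvPolynomial.aeval y f * (MvPolynomial.aeval y g * m') := by rw [map_mul]; ring
  rw [this]
  exact add_mem (hsSp_mul _ _ _ _ _ _ h) (hsSp_mul _ _ _ _ _ _ h')

theorem hsT_mul (s : MvPolynomial (Fin d) k) (j : ℤ) (m : R) (hm : hsT 𝒜 y x j m) :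
    hsT 𝒜 y x j (MvPolynomial.aeval y s * m) := by
  obtain ⟨f, hf, h⟩ := hm
  refine ⟨f, hf, ?_⟩
  rw [mul_left_comm]
  exact hsSp_mul _ _ _ _ _ _ h

theorem hsT_smul (c : k) (j : ℤ) (m : R) (hm : hsT 𝒜 y x j m) : hsT 𝒜 y x j (c • m) := by
  obtain ⟨f, hf, h⟩ := hm
  refine ⟨f, hf, ?_⟩
  rw [mul_smul_comm]
  exact Submodule.smul_mem _ _ h

theorem hsT_stable [GradedAlgebra 𝒜] (hstd : ∀ i : ℤ, 0 ≤ i → 𝒜 (i + 1) = 𝒜 1 * 𝒜 i)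
    (J : ℕ) (hJ : ∀ r ∈ 𝒜 J, hsT 𝒜 y x (J - 1) (r * x)) :
    ∀ N : ℕ, ∀ r ∈ 𝒜 N, hsT 𝒜 y x (J - 1) (r * x) := by
  have h1 : ∀ m ∈ hsSp 𝒜 y x J, hsT 𝒜 y x (J - 1) m := by
    intro m hm
    induction hm using Submodule.span_induction with
    | mem m hm =>
      obtain ⟨s', p, hp, r, hr, rfl⟩ := hm
      apply hsT_mul
      rcases hp.lt_or_eq with h | rfl
      · exact hsT_of_mem _ _ _ _ _ (hsSp_gen _ _ _ _ p (by omega) r hr)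
      · exact hJ r hr
    | zero => exact hsT_of_mem _ _ _ _ _ (zero_mem _)
    | add a b _ _ ha hb => exact hsT_add _ _ _ _ _ _ ha hb
    | smul c a _ ha => exact hsT_smul _ _ _ _ _ _ ha
  intro N
  induction N with
  | zero => intro r hr; exact h1 _ (hsSp_gen _ _ _ _ 0 (by omega) r hr)
  | succ N ih =>
    intro r hr
    push_cast at hr
    rw [hstd N (by omega)] at hr
    refine Submodule.mul_induction_on hr ?_ ?_
    · intro l hl r' hr'
      obtain ⟨f, hf, h⟩ := ih r' hr'
      have h2 := hsSp_deg _ _ _ _ l _ hl h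
      rw [sub_add_cancel] at h2
      obtain ⟨g, hg, h3⟩ := h1 _ h2
      refine ⟨g * f, mul_ne_zero hg hf, ?_⟩
      convert h3 using 1
      rw [map_mul]; ring
    · intro a b ha hb
      rw [add_mul]; exact hsT_add _ _ _ _ _ _ ha hb

theorem hsT_fg (j : ℤ) (V : Submodule k R) (hV : V.FG) :
    (∀ v ∈ V, hsT 𝒜 y x j v) → ∃ f : MvPolynomial (Fin d) k, f ≠ 0 ∧
      ∀ v ∈ V, MvPolynomial.aeval y f * v ∈ hsSp 𝒜 y x j := by
  refine Submodule.fg_induction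
    (motive := fun V _ => (∀ v ∈ V, hsT 𝒜 y x j v) → ∃ f : MvPolynomial (Fin d) k, f ≠ 0 ∧
      ∀ v ∈ V, MvPolynomial.aeval y f * v ∈ hsSp 𝒜 y x j) ?_ ?_ V hV
  · intro v h
    obtain ⟨f, hf, h'⟩ := h v (Submodule.mem_span_singleton_self v)
    refine ⟨f, hf, fun v' hv' => ?_⟩
    obtain ⟨c, rfl⟩ := Submodule.mem_span_singleton.mp hv'
    rw [mul_smul_comm]
    exact Submodule.smul_mem _ _ h'
  · intro V₁ _ V₂ _ h1 h2 h
    obtain ⟨f, hf, hf'⟩ := h1 fun v hv => h v (Submodule.mem_sup_left hv)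
    obtain ⟨g, hg, hg'⟩ := h2 fun v hv => h v (Submodule.mem_sup_right hv)
    refine ⟨f * g, mul_ne_zero hf hg, fun v hv => ?_⟩
    obtain ⟨v₁, hv₁, v₂, hv₂, rfl⟩ := Submodule.mem_sup.mp hv
    have : MvPolynomial.aeval y (f * g) * (v₁ + v₂) =
      MvPolynomial.aeval y g * (MvPolynomial.aeval y f * v₁) +
      MvPolynomial.aeval y f * (MvPolynomial.aeval y g * v₂) := by rw [map_mul]; ring
    rw [this]
    exact add_mem (hsSp_mul _ _ _ _ _ _ (hf' _ hv₁)) (hsSp_mul _ _ _ _ _ _ (hg' _ hv₂))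

theorem hs_indep (e : ℕ) (r : Fin e → R) (hr : ∀ j : Fin e, r j ∈ 𝒜 (j : ℕ))
    (hT : ∀ j : Fin e, ¬ hsT 𝒜 y x ((j : ℕ) - 1) (r j * x))
    (s : Fin e → MvPolynomial (Fin d) k) (hs : ∑ j, MvPolynomial.aeval y (s j) * (r j * x) = 0) :
    s = 0 := by
  classical
  by_contra hne
  have hne' : (Finset.univ.filter fun j : Fin e => s j ≠ 0).Nonempty := by
    obtain ⟨j, hj⟩ := Function.ne_iff.mp hne
    exact ⟨j, by simpa using hj⟩
  obtain ⟨j, hj, hmax⟩ := Finset.exists_max_image _ id hne'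
  refine hT j ⟨s j, (Finset.mem_filter.mp hj).2, ?_⟩
  rw [← Finset.add_sum_erase _ _ (Finset.mem_univ j)] at hs
  rw [eq_neg_of_add_eq_zero_left hs]
  refine neg_mem (sum_mem fun i hi => ?_)
  by_cases hi0 : s i = 0
  · simp [hi0]
  · have hle := hmax i (by simpa using hi0)
    have hlt : i < j := lt_of_le_of_ne hle (Finset.ne_of_mem_erase hi)
    have : (i : ℕ) < (j : ℕ) := hlt
    exact hsSp_mul _ _ _ _ _ _ (hsSp_gen _ _ _ _ (i : ℕ) (by omega) _ (hr i))

end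

section
variable {k R : Type*} [Field k] [CommRing R] [Algebra k R]
    (𝒜 : ℤ → Submodule k R) [GradedAlgebra 𝒜]

theorem hs_pow_span (n : ℕ) : (Ideal.span (𝒜 1 : Set R)) ^ n ≤ Ideal.span (𝒜 n : Set R) := by
  induction n with
  | zero =>
    rw [pow_zero, Ideal.one_eq_top, top_le_iff, Ideal.eq_top_iff_one]
    exact Ideal.subset_span (by exact_mod_cast SetLike.one_mem_graded 𝒜)
  | succ n ih =>
    rw [pow_succ]
    refine le_trans (Ideal.mul_mono_left ih) ?_
    rw [Ideal.span_mul_span', Ideal.span_le]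
    rintro _ ⟨a, ha, b, hb, rfl⟩
    apply Ideal.subset_span
    push_cast
    exact SetLike.mul_mem_graded ha hb

theorem hs_le_pow (hstd : ∀ i : ℤ, 0 ≤ i → 𝒜 (i + 1) = 𝒜 1 * 𝒜 i) (n : ℕ) :
    ∀ r ∈ 𝒜 n, r ∈ (Ideal.span (𝒜 1 : Set R)) ^ n := by
  induction n with
  | zero => intro r _; simp
  | succ n ih =>
    intro r hr
    push_cast at hr
    rw [hstd n (by omega)] at hr
    rw [pow_succ']
    refine Submodule.mul_induction_on hr ?_ ?_
    · intro l hl r' hr'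
      exact Ideal.mul_mem_mul (Ideal.subset_span hl) (ih r' hr')
    · intro a b ha hb
      exact add_mem ha hb

theorem hs_pow_comp (hneg : ∀ i : ℤ, i < 0 → 𝒜 i = ⊥) (n : ℕ) (r : R)
    (hr : r ∈ (Ideal.span (𝒜 1 : Set R)) ^ n) (p : ℤ) (hp : p < n) :
    (decompose 𝒜 r p : R) = 0 := by
  have h := hs_pow_span 𝒜 n hr
  clear hr
  have key : ∀ c : R, (decompose 𝒜 (r * c) p : R) = 0 := by
    induction h using Submodule.span_induction with
    | mem m hm =>
      intro c
      rw [hs_comp_left 𝒜 hm, hs_comp_neg 𝒜 hneg _ _ (by omega), mul_zero]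
    | zero => simp
    | add a b _ _ ha hb =>
      intro c
      rw [add_mul, decompose_add, DirectSum.add_apply, Submodule.coe_add, ha, hb, add_zero]
    | smul s a _ ha =>
      intro c
      rw [smul_eq_mul, mul_comm s a, mul_assoc]
      exact ha _
  simpa using key 1

theorem hs_mem_H (hneg : ∀ i : ℤ, i < 0 → 𝒜 i = ⊥) (H : Ideal R) (hH : H.IsHomogeneous 𝒜)
    (n : ℕ) (u : R) (hu : u ∈ H ⊔ (Ideal.span (𝒜 1 : Set R)) ^ n)
    (hu' : ∀ p : ℤ, n ≤ p → (decompose 𝒜 u p : R) = 0) : u ∈ H := by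
  apply hs_mem_of_comp 𝒜
  intro p
  by_cases hp : (n : ℤ) ≤ p
  · rw [hu' p hp]; exact H.zero_mem
  · obtain ⟨h, hh, m, hm, rfl⟩ := Submodule.mem_sup.mp hu
    rw [decompose_add, DirectSum.add_apply, Submodule.coe_add,
      hs_pow_comp 𝒜 hneg n m hm p (by omega), add_zero]
    exact hH p hh

theorem hs_monomial_mem {d : ℕ} (y : Fin d → R) (hy1 : ∀ t, y t ∈ 𝒜 1) (α : Fin d →₀ ℕ) :
    α.prod (fun t n => y t ^ n) ∈ 𝒜 (α.degree : ℕ) := by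
  rw [Finsupp.prod, Finsupp.degree_apply]
  push_cast
  apply SetLike.prod_mem_graded
  intro t _
  simpa using SetLike.pow_mem_graded (α t) (hy1 t)

theorem hs_poly_comp {d : ℕ} (y : Fin d → R) (hy1 : ∀ t, y t ∈ 𝒜 1)
    (s : MvPolynomial (Fin d) k) (m : ℕ) (hs : s.totalDegree ≤ m) (j : ℤ) (r : R) (hr : r ∈ 𝒜 j)
    (p : ℤ) (hp : m + j < p) : (decompose 𝒜 (MvPolynomial.aeval y s * r) p : R) = 0 := by
  classical
  rw [MvPolynomial.aeval_def, MvPolynomial.eval₂_eq', Finset.sum_mul, decompose_sum,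
    DFinsupp.finsetSum_apply, AddSubmonoidClass.coe_finsetSum]
  apply Finset.sum_eq_zero
  intro α hα
  have h1 := hs_monomial_mem 𝒜 y hy1 α
  have h2 : α.degree ≤ m := by
    rw [Finsupp.degree_eq_sum]
    refine le_trans ?_ hs
    have := MvPolynomial.le_totalDegree hα
    rwa [Finsupp.sum_fintype _ _ (by simp)] at this
  rw [Finsupp.prod_fintype _ _ (by simp)] at h1
  rw [mul_assoc, ← Algebra.smul_def]
  have h3 : MvPolynomial.coeff α s • ((∏ i, y i ^ α i) * r) ∈ 𝒜 (α.degree + j) :=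
    Submodule.smul_mem _ _ (SetLike.mul_mem_graded h1 hr)
  exact decompose_of_mem_ne 𝒜 h3 (by omega)

/-- the dimension count -/
theorem hs_dim (hneg : ∀ i : ℤ, i < 0 → 𝒜 i = ⊥) {d : ℕ} (y : Fin d → R) (hy1 : ∀ t, y t ∈ 𝒜 1)
    (x : R) (H : Ideal R) (hH : H.IsHomogeneous 𝒜) (hx : ∀ h ∈ H, h * x = 0)
    (hfl : ∀ n : ℕ, Module.Finite k (R ⧸ (H ⊔ (Ideal.span (𝒜 1 : Set R)) ^ n)))
    (e : ℕ) (r : Fin (e + 1) → R) (hr : ∀ j : Fin (e + 1), r j ∈ 𝒜 (j : ℕ))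
    (hT : ∀ j : Fin (e + 1), ¬ hsT 𝒜 y x ((j : ℕ) - 1) (r j * x)) (m : ℕ) :
    (e + 1) * m ^ d ≤ d.factorial *
      Module.finrank k (R ⧸ (H ⊔ (Ideal.span (𝒜 1 : Set R)) ^ (m + e + 1))) := by
  have := hfl (m + e + 1)
  let Q := R ⧸ (H ⊔ (Ideal.span (𝒜 1 : Set R)) ^ (m + e + 1))
  let L : (Fin (e + 1) → MvPolynomial.restrictTotalDegree (Fin d) k m) →ₗ[k] R :=
    ∑ j, (LinearMap.mulRight k (r j)) ∘ₗ (MvPolynomial.aeval y).toLinearMap ∘ₗ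
      (MvPolynomial.restrictTotalDegree (Fin d) k m).subtype ∘ₗ LinearMap.proj j
  have hL : ∀ s, L s = ∑ j, MvPolynomial.aeval y (s j).1 * r j := by
    intro s
    simp [L, LinearMap.sum_apply]
  let π : R →ₗ[k] Q := (Ideal.Quotient.mkₐ k _).toLinearMap
  have hinj : Function.Injective (π ∘ₗ L) := by
    rw [← LinearMap.ker_eq_bot, LinearMap.ker_eq_bot']
    intro s hs
    have h1 : L s ∈ H ⊔ (Ideal.span (𝒜 1 : Set R)) ^ (m + e + 1) := Ideal.Quotient.eq_zero_iff_mem.mp hs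
    have h2 : L s ∈ H := by
      refine hs_mem_H 𝒜 hneg H hH _ _ h1 ?_
      intro p hp
      rw [hL, decompose_sum, DFinsupp.finsetSum_apply, AddSubmonoidClass.coe_finsetSum]
      refine Finset.sum_eq_zero fun j _ => ?_
      refine hs_poly_comp 𝒜 y hy1 _ m ((MvPolynomial.mem_restrictTotalDegree _ _ _).mp (s j).2)
        _ _ (hr j) p ?_
      have := j.2
      push_cast at hp
      omega
    have h3 := hx _ h2
    rw [hL, Finset.sum_mul] at h3
    have h4 := hs_indep 𝒜 y x (e + 1) r hr hT (fun j => (s j).1) (by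
      simpa only [mul_assoc] using h3)
    ext1 j
    exact Subtype.ext (congrFun h4 j)
  have h5 := LinearMap.finrank_le_finrank_of_injective hinj
  rw [Module.finrank_pi_fintype, Finset.sum_const, Finset.card_univ, Fintype.card_fin,
    smul_eq_mul] at h5
  calc (e + 1) * m ^ d ≤ (e + 1) * (d.factorial *
        Module.finrank k (MvPolynomial.restrictTotalDegree (Fin d) k m)) :=
        Nat.mul_le_mul_left _ (hs_count k d m)
    _ = d.factorial * ((e + 1) *
        Module.finrank k (MvPolynomial.restrictTotalDegree (Fin d) k m)) := by ring
    _ ≤ _ := Nat.mul_le_mul_left _ h5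

end

theorem hs_limit (F : ℕ → ℕ) (d δ e : ℕ) (hδ : δ ≤ d)
    (hF : ∀ m, (e + 1) * m ^ d ≤ d.factorial * F (m + e + 1))
    (he : Filter.Tendsto (fun n : ℕ => (F n : ℝ) * (Nat.factorial δ) / (n : ℝ) ^ δ)
      Filter.atTop (nhds (e : ℝ))) : False := by
  have hl : Filter.Tendsto (fun m : ℕ => ((e : ℝ) + 1) * ((m : ℝ) / (m + ((e + 1 : ℕ) : ℝ))) ^ d)
      Filter.atTop (nhds (((e : ℝ) + 1) * 1 ^ d)) :=
    ((tendsto_natCast_div_add_atTop ((e + 1 : ℕ) : ℝ)).pow d).const_mul _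
  have he' := he.comp (Filter.tendsto_add_atTop_nat (e + 1))
  have hle := le_of_tendsto_of_tendsto hl he' (by
    filter_upwards [Filter.eventually_ge_atTop d] with m hm
    simp only [Function.comp]
    set n := m + (e + 1) with hn
    have hnpos : (0 : ℝ) < n := by rw [hn]; positivity
    have h1 : ((e : ℝ) + 1) * (m : ℝ) ^ d ≤ d.factorial * F n := by exact_mod_cast hF m
    obtain ⟨q, rfl⟩ := Nat.exists_eq_add_of_le hδ
    have h2 : ((δ + q).factorial : ℝ) ≤ δ.factorial * (n : ℝ) ^ q := by
      exact_mod_cast hs_fact δ n q (by omega)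
    have e1 : (m : ℝ) + ((e + 1 : ℕ) : ℝ) = n := by rw [hn]; push_cast; ring
    rw [e1, div_pow, ← mul_div_assoc, div_le_div_iff₀ (by positivity) (by positivity)]
    calc ((e : ℝ) + 1) * (m : ℝ) ^ (δ + q) * (n : ℝ) ^ δ
        ≤ ((δ + q).factorial * F n) * (n : ℝ) ^ δ := by gcongr
      _ ≤ ((δ.factorial * (n : ℝ) ^ q) * F n) * (n : ℝ) ^ δ := by gcongr
      _ = _ := by rw [pow_add]; ring)
  simp at hle
  linarith

section
variable {k R : Type*} [Field k] [CommRing R] [Algebra k R]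
    (𝒜 : ℤ → Submodule k R) [GradedAlgebra 𝒜]

theorem hs_fg (hneg : ∀ i : ℤ, i < 0 → 𝒜 i = ⊥)
    (x : R) (H : Ideal R) (hH : H.IsHomogeneous 𝒜) (hx : ∀ h ∈ H, h * x = 0)
    (hfl : ∀ n : ℕ, Module.Finite k (R ⧸ (H ⊔ (Ideal.span (𝒜 1 : Set R)) ^ n))) (N : ℕ) :
    ((𝒜 N).map (LinearMap.mulRight k x)).FG := by
  have := hfl (N + 1)
  let π : R →ₗ[k] (R ⧸ (H ⊔ (Ideal.span (𝒜 1 : Set R)) ^ (N + 1))) :=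
    (Ideal.Quotient.mkₐ k _).toLinearMap
  let g := π ∘ₗ (𝒜 N).subtype
  let h := LinearMap.mulRight k x ∘ₗ (𝒜 N).subtype
  have hle : LinearMap.ker g ≤ LinearMap.ker h := by
    intro r hr
    have h1 : (r : R) ∈ H ⊔ (Ideal.span (𝒜 1 : Set R)) ^ (N + 1) :=
      Ideal.Quotient.eq_zero_iff_mem.mp hr
    have h2 := hs_mem_H 𝒜 hneg H hH _ _ h1 (fun p hp =>
      decompose_of_mem_ne 𝒜 r.2 (by push_cast at hp; omega))
    exact hx _ h2
  have hfin : Module.Finite k (𝒜 N ⧸ LinearMap.ker g) :=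
    Module.Finite.equiv g.quotKerEquivRange.symm
  have e : (𝒜 N).map (LinearMap.mulRight k x) = LinearMap.range ((LinearMap.ker g).liftQ h hle) := by
    rw [Submodule.range_liftQ, LinearMap.range_comp, Submodule.range_subtype]
  rw [e]
  exact Module.Finite.iff_fg.mp inferInstance

theorem hs_exists_f (hneg : ∀ i : ℤ, i < 0 → 𝒜 i = ⊥) {d : ℕ} (y : Fin d → R)
    (hy1 : ∀ t, y t ∈ 𝒜 1)
    (x : R) (H : Ideal R) (hH : H.IsHomogeneous 𝒜) (hx : ∀ h ∈ H, h * x = 0)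
    (hfl : ∀ n : ℕ, Module.Finite k (R ⧸ (H ⊔ (Ideal.span (𝒜 1 : Set R)) ^ n)))
    (j : ℤ) (hall : ∀ N : ℕ, ∀ r ∈ 𝒜 N, hsT 𝒜 y x j (r * x))
    (N₀ : ℕ) (hN₀ : ∀ n : ℕ, N₀ < n → ∀ r ∈ 𝒜 n, r ∈ Ideal.span (Set.range y)) :
    ∃ f : MvPolynomial (Fin d) k, f ≠ 0 ∧
      ∀ r : R, MvPolynomial.aeval y f * (r * x) ∈ hsSp 𝒜 y x j := by
  classical
  have h1 : ∀ N : ℕ, ∃ f : MvPolynomial (Fin d) k, f ≠ 0 ∧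
      ∀ r ∈ 𝒜 N, MvPolynomial.aeval y f * (r * x) ∈ hsSp 𝒜 y x j := by
    intro N
    obtain ⟨f, hf, h⟩ := hsT_fg 𝒜 y x j _ (hs_fg 𝒜 hneg x H hH hx hfl N) (by
      rintro _ ⟨r, hr, rfl⟩
      exact hall N r hr)
    exact ⟨f, hf, fun r hr => h _ ⟨r, hr, rfl⟩⟩
  choose F hF0 hF using h1
  refine ⟨∏ N ∈ Finset.range (N₀ + 1), F N, Finset.prod_ne_zero_iff.mpr fun N _ => hF0 N, ?_⟩
  set f := ∏ N ∈ Finset.range (N₀ + 1), F N with hf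
  have small : ∀ N ≤ N₀, ∀ r ∈ 𝒜 (N : ℕ), MvPolynomial.aeval y f * (r * x) ∈ hsSp 𝒜 y x j := by
    intro N hN r hr
    rw [hf, ← Finset.prod_erase_mul _ _ (Finset.mem_range.mpr (Nat.lt_succ_of_le hN)), map_mul,
      mul_assoc]
    exact hsSp_mul _ _ _ _ _ _ (hF N r hr)
  have big : ∀ M : ℕ, ∀ r ∈ 𝒜 ((N₀ + M : ℕ) : ℤ),
      MvPolynomial.aeval y f * (r * x) ∈ hsSp 𝒜 y x j := by
    intro M
    induction M with
    | zero => exact small N₀ le_rfl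
    | succ M ih =>
      intro r hr
      have h2 := hN₀ (N₀ + (M + 1)) (by omega) r hr
      obtain ⟨c, hc⟩ := (Ideal.mem_span_range_iff_exists_fun).mp h2
      have h3 : r = ∑ t, y t * (decompose 𝒜 (c t) ((N₀ + M : ℕ) : ℤ) : R) := by
        conv_lhs => rw [← decompose_of_mem_same 𝒜 hr, ← hc]
        rw [decompose_sum, DFinsupp.finsetSum_apply, AddSubmonoidClass.coe_finsetSum]
        refine Finset.sum_congr rfl fun t _ => ?_
        rw [mul_comm, hs_comp_left 𝒜 (hy1 t)]
        rw [show ((N₀ + (M + 1) : ℕ) : ℤ) - 1 = ((N₀ + M : ℕ) : ℤ) by push_cast; ring]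
      rw [h3, Finset.sum_mul, Finset.mul_sum]
      refine sum_mem fun t _ => ?_
      have h4 := hsSp_mul 𝒜 y x (MvPolynomial.X t) _ _ (ih _ (decompose 𝒜 (c t) ((N₀ + M : ℕ) : ℤ)).2)
      rw [MvPolynomial.aeval_X] at h4
      convert h4 using 1
      ring
  have hom : ∀ N : ℕ, ∀ r ∈ 𝒜 N, MvPolynomial.aeval y f * (r * x) ∈ hsSp 𝒜 y x j := by
    intro N r hr
    rcases le_total N N₀ with h | h
    · exact small N h r hr
    · obtain ⟨M, rfl⟩ := Nat.exists_eq_add_of_le h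
      exact big M r hr
  intro r
  rw [← DirectSum.sum_support_decompose 𝒜 r, Finset.sum_mul, Finset.mul_sum]
  refine sum_mem fun p _ => ?_
  rcases lt_or_ge p 0 with hp | hp
  · rw [hs_comp_neg 𝒜 hneg r p hp]; simp
  · obtain ⟨N, rfl⟩ := Int.eq_ofNat_of_zero_le hp
    exact hom N _ (decompose 𝒜 r N).2

variable {ω : Type*} [AddCommGroup ω] [Module R ω] [Module k ω] [IsScalarTower k R ω]
    (w : ℤ → Submodule k ω) [DirectSum.Decomposition w]

theorem hs_wcomp (hwsmul : ∀ (p q : ℤ), ∀ r ∈ 𝒜 p, ∀ x ∈ w q, r • x ∈ w (p + q))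
    (p q : ℤ) (r : R) (hr : r ∈ 𝒜 p) (u : ω) :
    (decompose w (r • u) q : ω) = r • (decompose w u (q - p) : ω) := by
  induction u using DirectSum.Decomposition.inductionOn w with
  | zero => simp
  | homogeneous m =>
    rename_i i
    have h1 := hwsmul p i r hr m m.2
    by_cases h : p + i = q
    · subst h
      rw [decompose_of_mem_same w h1, add_sub_cancel_left, decompose_of_mem_same w m.2]
    · rw [decompose_of_mem_ne w h1 h, decompose_of_mem_ne w m.2 (by omega), smul_zero]
  | add a b ha hb =>
    rw [smul_add, decompose_add, decompose_add, DirectSum.add_apply, DirectSum.add_apply,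
      Submodule.coe_add, Submodule.coe_add, smul_add, ha, hb]

/-- `(y^n) ω` is homogeneous -/
theorem hs_Q_comp (hwsmul : ∀ (p q : ℤ), ∀ r ∈ 𝒜 p, ∀ x ∈ w q, r • x ∈ w (p + q))
    {d : ℕ} (y : Fin d → R) (hy1 : ∀ t, y t ∈ 𝒜 1) (n : ℕ) (u : ω)
    (hu : u ∈ (Ideal.span (Set.range fun t => y t ^ n)) • (⊤ : Submodule R ω)) :
    ∃ c : Fin d → ω, ∀ q : ℤ, (decompose w u q : ω) =
      ∑ t, y t ^ n • (decompose w (c t) (q - n) : ω) := by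
  classical
  have h1 : ∃ c : Fin d → ω, u = ∑ t, y t ^ n • c t := by
    refine Submodule.smul_induction_on hu ?_ ?_
    · intro r hr v _
      obtain ⟨c, rfl⟩ := (Ideal.mem_span_range_iff_exists_fun).mp hr
      refine ⟨fun t => c t • v, ?_⟩
      rw [Finset.sum_smul]
      refine Finset.sum_congr rfl fun t _ => ?_
      rw [smul_smul, mul_comm]
    · rintro _ _ ⟨c, rfl⟩ ⟨c', rfl⟩
      refine ⟨c + c', ?_⟩
      simp [smul_add, Finset.sum_add_distrib]
  obtain ⟨c, rfl⟩ := h1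
  refine ⟨c, fun q => ?_⟩
  rw [decompose_sum, DFinsupp.finsetSum_apply, AddSubmonoidClass.coe_finsetSum]
  refine Finset.sum_congr rfl fun t _ => ?_
  have hyp : y t ^ n ∈ 𝒜 (n : ℤ) := by
    simpa using SetLike.pow_mem_graded n (hy1 t)
  exact hs_wcomp 𝒜 w hwsmul n q _ hyp _

theorem hs_Q_mem {d : ℕ} (y : Fin d → R) (n : ℕ) (t : Fin d) (v : ω) :
    y t ^ n • v ∈ (Ideal.span (Set.range fun t => y t ^ n)) • (⊤ : Submodule R ω) :=
  Submodule.smul_mem_smul (Ideal.subset_span ⟨t, rfl⟩) Submodule.mem_top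

/-- elements of the `k[y]`-span of the part of degree `< d` have degree `n d` component in
`(y^n) ω`. -/
theorem hs_P_comp (hwsmul : ∀ (p q : ℤ), ∀ r ∈ 𝒜 p, ∀ x ∈ w q, r • x ∈ w (p + q))
    {d : ℕ} (y : Fin d → R) (hy1 : ∀ t, y t ∈ 𝒜 1) (n : ℕ) (u : ω)
    (hu : u ∈ Submodule.span k {m : ω | ∃ s : MvPolynomial (Fin d) k, ∃ q < (d : ℤ), ∃ v ∈ w q,
      m = MvPolynomial.aeval y s • v}) :
    (decompose w u ((n : ℤ) * d) : ω) ∈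
      (Ideal.span (Set.range fun t => y t ^ n)) • (⊤ : Submodule R ω) := by
  have hsm : ∀ (c : k) (v : ω), c • v = algebraMap k R c • v := fun c v =>
    (algebraMap_smul R c v).symm
  induction hu using Submodule.span_induction with
  | mem m hm =>
    obtain ⟨s, q, hq, v, hv, rfl⟩ := hm
    rw [MvPolynomial.aeval_def, MvPolynomial.eval₂_eq', Finset.sum_smul, decompose_sum,
      DFinsupp.finsetSum_apply, AddSubmonoidClass.coe_finsetSum]
    refine sum_mem fun α _ => ?_
    have h1 := hs_monomial_mem 𝒜 y hy1 α
    rw [Finsupp.prod_fintype _ _ (by simp)] at h1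
    have h2 := hwsmul _ _ _ h1 v hv
    rw [mul_smul, ← hsm, decompose_smul, DirectSum.smul_apply, Submodule.coe_smul, hsm]
    apply Submodule.smul_mem
    by_cases h : (α.degree : ℤ) + q = n * d
    · rw [← h, decompose_of_mem_same w h2]
      have h3 : ∃ t, n ≤ α t := by
        by_contra! hcon
        have h4 : ∑ t, (α t + 1) ≤ ∑ _t : Fin d, n := Finset.sum_le_sum fun t _ => hcon t
        rw [Finset.sum_add_distrib, ← Finsupp.degree_eq_sum] at h4
        simp at h4
        have h5 : (α.degree : ℤ) + d ≤ d * n := by exact_mod_cast h4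
        rw [mul_comm] at h
        omega
      obtain ⟨t, ht⟩ := h3
      have h4 : (∏ i, y i ^ α i) = y t ^ n * (y t ^ (α t - n) * ∏ i ∈ Finset.univ.erase t, y i ^ α i) := by
        rw [← Finset.mul_prod_erase _ _ (Finset.mem_univ t), ← mul_assoc, ← pow_add,
          Nat.add_sub_cancel' ht]
      rw [h4, mul_smul]
      exact hs_Q_mem y n t _
    · rw [decompose_of_mem_ne w h2 h]
      exact zero_mem _
  | zero => simp
  | add a b _ _ ha hb =>
    rw [decompose_add, DirectSum.add_apply, Submodule.coe_add]; exact add_mem ha hb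
  | smul c a _ ha =>
    rw [decompose_smul, DirectSum.smul_apply, Submodule.coe_smul, hsm]
    exact Submodule.smul_mem _ _ ha

/-- the socle argument -/
theorem hs_socle [IsNoetherianRing R] (hneg : ∀ i : ℤ, i < 0 → 𝒜 i = ⊥)
    (hstd : ∀ i : ℤ, 0 ≤ i → 𝒜 (i + 1) = 𝒜 1 * 𝒜 i)
    (hwsmul : ∀ (p q : ℤ), ∀ r ∈ 𝒜 p, ∀ x ∈ w q, r • x ∈ w (p + q))
    {d : ℕ} (y : Fin d → R) (hy1 : ∀ t, y t ∈ 𝒜 1)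
    (hsop : Ideal.span (𝒜 1 : Set R) ≤ (Ideal.span (Set.range y)).radical)
    (a : ℤ) (hbelow : ∀ p : ℤ, p < -a → w p = ⊥)
    (hsoc : ∀ n : ℕ, ∀ x : ω,
      (∀ m ∈ Ideal.span (𝒜 1 : Set R),
        m • x ∈ (Ideal.span (Set.range fun t => y t ^ n)) • (⊤ : Submodule R ω)) →
      ∃ u ∈ (Ideal.span (Set.range fun t => y t ^ n)) • (⊤ : Submodule R ω),
        ∃ v ∈ w ((n : ℤ) * d), x = u + v)
    (u : ω) (hu0 : u ≠ 0)
    (hu : ∀ r : R, r • u ∈ Submodule.span k {m : ω | ∃ s : MvPolynomial (Fin d) k,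
      ∃ q < (d : ℤ), ∃ v ∈ w q, m = MvPolynomial.aeval y s • v}) : False := by
  classical
  have hwneg : ∀ (v : ω) (p : ℤ), p < -a → (decompose w v p : ω) = 0 := by
    intro v p hp
    have h1 : ∀ z ∈ w p, z = 0 := by
      intro z hz
      rwa [hbelow p hp, Submodule.mem_bot] at hz
    exact h1 _ (decompose w v p).2
  obtain ⟨q, hq⟩ : ∃ q, (decompose w u q : ω) ≠ 0 := by
    by_contra! hcon
    apply hu0
    rw [← DirectSum.sum_support_decompose w u]
    exact Finset.sum_eq_zero fun p _ => hcon p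
  set uq : ω := (decompose w u q : ω) with huq
  have huqm : uq ∈ w q := (decompose w u q).2
  obtain ⟨n, hn⟩ : ∃ n : ℕ, q - n < -a := ⟨(q + a + 1).toNat, by omega⟩
  set I : Ideal R := Ideal.span (Set.range fun t => y t ^ n) with hI
  have hnot : uq ∉ I • (⊤ : Submodule R ω) := by
    intro h
    obtain ⟨c, hc⟩ := hs_Q_comp 𝒜 w hwsmul y hy1 n uq h
    have := hc q
    rw [decompose_of_mem_same w huqm] at this
    apply hq
    rw [this]
    exact Finset.sum_eq_zero fun t _ => by rw [hwneg _ _ hn, smul_zero]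
  obtain ⟨K, hK⟩ : ∃ K : ℕ, (Ideal.span (𝒜 1 : Set R)) ^ K ≤ I := by
    apply Ideal.exists_pow_le_of_le_radical_of_fg _ (IsNoetherian.noetherian _)
    refine hsop.trans ?_
    rw [Ideal.radical_le_radical_iff, Ideal.span_le]
    rintro _ ⟨t, rfl⟩
    exact ⟨n, Ideal.subset_span ⟨t, rfl⟩⟩
  let S : ℕ → Prop := fun N => ∃ r ∈ 𝒜 (N : ℤ), r • uq ∉ I • (⊤ : Submodule R ω)
  have hS0 : S 0 := ⟨1, SetLike.one_mem_graded 𝒜, by rwa [one_smul]⟩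
  have hSK : ∀ N, S N → N ≤ K := by
    rintro N ⟨r, hr, h⟩
    by_contra! hcon
    apply h
    exact Submodule.smul_mem_smul (hK (Ideal.pow_le_pow_right hcon.le
      (hs_le_pow 𝒜 hstd N r hr))) Submodule.mem_top
  have hmax := Nat.findGreatest_spec (P := S) (Nat.zero_le K) hS0
  set N := Nat.findGreatest S K with hN
  have hmax' : ¬ S (N + 1) := fun h => by
    have := Nat.le_findGreatest (hSK _ h) h
    omega
  obtain ⟨r, hr, hru⟩ := hmax
  have hz : r • uq ∈ w (N + q) := hwsmul _ _ _ hr _ huqm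
  obtain ⟨u', hu', v, hv, huv⟩ := hsoc n (r • uq) (by
    intro m hm
    induction hm using Submodule.span_induction with
    | mem l hl =>
      by_contra hcon
      apply hmax'
      refine ⟨l * r, ?_, by rwa [mul_smul]⟩
      push_cast
      rw [add_comm]
      exact SetLike.mul_mem_graded hl hr
    | zero => simp
    | add a b _ _ ha hb => rw [add_smul]; exact add_mem ha hb
    | smul c a _ ha => rw [smul_assoc]; exact Submodule.smul_mem _ _ ha)
  by_cases hdeg : (N : ℤ) + q = n * d
  · have h1 := hs_P_comp 𝒜 w hwsmul y hy1 n _ (hu r)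
    rw [hs_wcomp 𝒜 w hwsmul N _ r hr, ← hdeg, add_sub_cancel_left] at h1
    exact hru h1
  · obtain ⟨c, hc⟩ := hs_Q_comp 𝒜 w hwsmul y hy1 n u' hu'
    apply hru
    have h1 := decompose_of_mem_same w hz
    rw [huv, decompose_add, DirectSum.add_apply, Submodule.coe_add,
      decompose_of_mem_ne w hv (Ne.symm hdeg), add_zero, hc] at h1
    rw [huv, ← h1]
    exact sum_mem fun t _ => hs_Q_mem y n t _

end

end

/-- **Proposition 3.14**: Let `R` be a standard graded Cohen–Macaulay `k`-algebra of
dimension `d` and `H` a homogeneous `R`-ideal.  Writing `c = c(R)` for the negative of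
the largest generator degree of the canonical module `ω`, one has
`indeg(0 : H) ≥ c + d + 1 - e(R/H)`, where `e(R/H)` is the multiplicity of `R/H`. -/
theorem statement_16
    {k R : Type*} [Field k] [CommRing R] [Algebra k R] [IsNoetherianRing R]
    -- `R` is standard graded over `k`:
    (𝒜 : ℤ → Submodule k R) [GradedAlgebra 𝒜]
    (hneg : ∀ i : ℤ, i < 0 → 𝒜 i = ⊥)
    (hstd : ∀ i : ℤ, 0 ≤ i → 𝒜 (i + 1) = 𝒜 1 * 𝒜 i)
    -- of dimension `d ≥ 1`:
    (d : ℕ) (hd : 1 ≤ d) (hdim : ringKrullDim R = d)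
    -- `𝔪` is the homogeneous maximal ideal:
    (𝔪 : Ideal R) (h𝔪 : 𝔪 = Ideal.span (𝒜 1 : Set R))
    -- `y` is a linear system of parameters; its regularity encodes that `R` is Cohen–Macaulay:
    (y : Fin d → R) (hy1 : ∀ t, y t ∈ 𝒜 1)
    (hyreg : RingTheory.Sequence.IsRegular R (List.ofFn y))
    (J : Ideal R) (hJ : J = Ideal.span (Set.range y))
    (hsop : 𝔪 ≤ J.radical)
    -- the `a`-invariant (the negative of the initial degree of the canonical module `ω`):
    (a : ℤ) (ha : 0 ≤ a + d)
    -- `J` is a reduction of `𝔪` with reduction number `a + d`: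
    (hred : ∀ n : ℤ, a + d ≤ n → ipow 𝔪 (n + 1) = J * ipow 𝔪 n)
    -- `ω` is the graded canonical module of `R`: a finitely generated faithful graded
    -- maximal Cohen–Macaulay module with initial degree `-a`, generated in degrees `≤ d`,
    -- whose Artinian reductions `ω/J^{[n]}ω` have socle concentrated in degree `n·d`:
    {ω : Type*} [AddCommGroup ω] [Module R ω] [Module k ω] [IsScalarTower k R ω]
    (w : ℤ → Submodule k ω)
    (hwint : DirectSum.IsInternal w)
    (hwsmul : ∀ (p q : ℤ), ∀ r ∈ 𝒜 p, ∀ x ∈ w q, r • x ∈ w (p + q))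
    [Module.Finite R ω]
    (hfaith : Module.annihilator R ω = ⊥)
    (hbelow : ∀ p : ℤ, p < -a → w p = ⊥)
    (hinit : w (-a) ≠ ⊥)
    (hgend : Submodule.span R (⋃ p : ℤ, ⋃ (_ : p ≤ (d : ℤ)), (w p : Set ω)) = ⊤)
    (hregw : RingTheory.Sequence.IsRegular ω (List.ofFn y))
    (hsoc : ∀ n : ℕ, ∀ x : ω,
      (∀ m ∈ 𝔪, m • x ∈ (Ideal.span (Set.range fun t => y t ^ n)) • (⊤ : Submodule R ω)) →
      ∃ u ∈ (Ideal.span (Set.range fun t => y t ^ n)) • (⊤ : Submodule R ω),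
        ∃ v ∈ w ((n : ℤ) * d), x = u + v)
    -- `c = c(R)`: `ω` is generated in degrees `≤ -c` but not in degrees `≤ -c - 1`:
    (c : ℤ)
    (hc1 : Submodule.span R (⋃ p : ℤ, ⋃ (_ : p ≤ -c), (w p : Set ω)) = ⊤)
    (hc2 : Submodule.span R (⋃ p : ℤ, ⋃ (_ : p ≤ -c - 1), (w p : Set ω)) ≠ ⊤)
    -- `H` is a homogeneous ideal with `0 : H ≠ 0`:
    (H : Ideal R) (hH : Ideal.IsHomogeneous 𝒜 H)
    (h0 : Submodule.colon (⊥ : Ideal R) H ≠ ⊥)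
    -- `e` is the multiplicity of `R/H` with respect to `𝔪`, where `δ = dim R/H`:
    (δ : ℕ) (hδ : ringKrullDim (R ⧸ H) = δ)
    (hfl : ∀ n : ℕ, Module.Finite k (R ⧸ (H ⊔ 𝔪 ^ n)))
    (e : ℕ)
    (he : Filter.Tendsto
      (fun n : ℕ => (Module.finrank k (R ⧸ (H ⊔ 𝔪 ^ n)) : ℝ) * (Nat.factorial δ) / (n : ℝ) ^ δ)
      Filter.atTop (nhds (e : ℝ))) :
    -- `indeg (0 : H) ≥ c + d + 1 - e`:
    ∀ i : ℤ, ∀ x ∈ 𝒜 i, x ∈ Submodule.colon (⊥ : Ideal R) H → x ≠ 0 →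
      c + d + 1 - (e : ℤ) ≤ i := by
  subst h𝔪 hJ
  intro i x hxi hxH hx0
  have hx : ∀ h ∈ H, h * x = 0 := by
    intro h hh
    have := Submodule.mem_colon.mp hxH h hh
    rw [Submodule.mem_bot, smul_eq_mul] at this
    rw [mul_comm, this]
  letI : DirectSum.Decomposition w := hwint.chooseDecomposition
  by_contra hlt
  by_cases hcase : ∃ J : ℕ, J ≤ e ∧ ∀ r ∈ 𝒜 J, hsT 𝒜 y x (J - 1) (r * x)
  · obtain ⟨J, hJe, hJ⟩ := hcase
    have hall := hsT_stable 𝒜 y x hstd J hJ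
    obtain ⟨f, hf, hfr⟩ := hs_exists_f 𝒜 hneg y hy1 x H hH hx hfl _ hall (a + d).toNat (by
      intro n hn r hr
      have h1 := hred (a + d) le_rfl
      have h2 : Ideal.span (𝒜 1 : Set R) ^ ((a + d).toNat + 1) ≤ Ideal.span (Set.range y) := by
        have e1 : (a + d + 1).toNat = (a + d).toNat + 1 := by omega
        unfold ipow at h1
        rw [e1] at h1
        rw [h1]
        exact le_trans Ideal.mul_le_inf inf_le_left
      exact h2 (Ideal.pow_le_pow_right hn (hs_le_pow 𝒜 hstd n r hr)))
    have hfx : MvPolynomial.aeval y f * x ≠ 0 := fun h =>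
      hx0 (hs_tf 𝒜 hneg y hy1 hyreg f hf x h)
    obtain ⟨v, hv⟩ : ∃ v : ω, (MvPolynomial.aeval y f * x) • v ≠ 0 := by
      by_contra! hcon
      apply hfx
      have : MvPolynomial.aeval y f * x ∈ Module.annihilator R ω :=
        Module.mem_annihilator.mpr hcon
      rwa [hfaith] at this
    have hP : ∀ v' : ω, ∀ r : R, (MvPolynomial.aeval y f * (r * x)) • v' ∈
        Submodule.span k {m : ω | ∃ s : MvPolynomial (Fin d) k,
          ∃ q < (d : ℤ), ∃ v ∈ w q, m = MvPolynomial.aeval y s • v} := by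
      intro v'
      have hv' : v' ∈ Submodule.span R (⋃ p : ℤ, ⋃ (_ : p ≤ -c), (w p : Set ω)) := by
        rw [hc1]; exact Submodule.mem_top
      induction hv' using Submodule.span_induction with
      | mem v' hv' =>
        intro r
        simp only [Set.mem_iUnion] at hv'
        obtain ⟨q, hq, hvq⟩ := hv'
        have h1 := hfr r
        generalize MvPolynomial.aeval y f * (r * x) = m at h1 ⊢
        induction h1 using Submodule.span_induction with
        | mem m hm =>
          obtain ⟨s, p, hp, r', hr', rfl⟩ := hm
          refine Submodule.subset_span ⟨s, p + i + q, ?_, (r' * x) • v', ?_, ?_⟩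
          · omega
          · exact hwsmul _ _ _ (SetLike.mul_mem_graded hr' hxi) _ hvq
          · rw [mul_smul]
        | zero => simp
        | add a b _ _ ha hb => rw [add_smul]; exact add_mem ha hb
        | smul c a _ ha => rw [smul_assoc]; exact Submodule.smul_mem _ _ ha
      | zero => simp
      | add a b _ _ ha hb => intro r; rw [smul_add]; exact add_mem (ha r) (hb r)
      | smul c a _ ha =>
        intro r
        rw [smul_smul]
        convert ha (r * c) using 2
        ring
    refine hs_socle 𝒜 w hneg hstd hwsmul y hy1 hsop a hbelow hsoc _ hv ?_
    intro r
    rw [smul_smul]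
    convert hP v r using 2
    ring
  · push Not at hcase
    have hcase' : ∀ j : Fin (e + 1), ∃ r ∈ 𝒜 ((j : ℕ) : ℤ), ¬ hsT 𝒜 y x ((j : ℕ) - 1) (r * x) :=
      fun j => hcase j (Nat.lt_succ_iff.mp j.2)
    choose r hr hT using hcase'
    have hδd : δ ≤ d := by
      have := ringKrullDim_quotient_le H
      rw [hδ, hdim] at this
      exact_mod_cast this
    exact hs_limit _ d δ e hδd (hs_dim 𝒜 hneg y hy1 x H hH hx hfl e r hr hT) he
end
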